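/- For every permutation w ∈ S_n, the chute move poset PD(w) is a lattice. -/

import Mathlib

open Classical

noncomputable section

/-- 1-based value of a permutation of `Fin n` at a 1-based position `j`. -/
def permVal {n : ℕ} (w : Equiv.Perm (Fin n)) (j : ℕ) : ℕ :=
  if h : 1 ≤ j ∧ j ≤ n then (w ⟨j - 1, by omega⟩ : ℕ) + 1 else 0

/-- `(i,j)` is an inversion of `w`: `1 ≤ i < j ≤ n` and the (1-based) position of the
value `j` in the one-line notation of `w` precedes that of `i`. -/
def IsInv {n : ℕ} (w : Equiv.Perm (Fin n)) (i j : ℕ) : Prop :=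
  1 ≤ i ∧ i < j ∧ j ≤ n ∧ permVal w.symm j < permVal w.symm i

/-- Lehmer form entry at box `(i,j)`: the number of `k ∈ [1, T(i,j)-1]` that do not
appear below box `(i,j)` in column `j`. -/
def lehmer (T : ℕ → ℕ → ℕ) (i j : ℕ) : ℕ :=
  ((Finset.Ico 1 (T i j)).filter fun k => ∀ i', 1 ≤ i' → i' < i → T i' j ≠ k).card

/-- Incrementing box `(i,j)` of `T` yields `T'`:  with `a = T(i,j)` and `b` the smallest
integer greater than `a` not appearing below `(i,j)` in column `j`, either a pure
increment (if `b` is absent from column `j`) or a trade increment (swap `a` and `b`). -/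
def IncrementAt (T T' : ℕ → ℕ → ℕ) (i j : ℕ) : Prop :=
  ∃ b, T i j < b ∧
    (∀ k, T i j < k → k < b → ∃ i', 1 ≤ i' ∧ i' < i ∧ T i' j = k) ∧
    (∀ i', 1 ≤ i' → i' < i → T i' j ≠ b) ∧
    (((∀ i', 1 ≤ i' → T i' j ≠ b) ∧
        T' = fun a c => if a = i ∧ c = j then b else T a c) ∨
      (∃ i'', i < i'' ∧ T i'' j = b ∧
        T' = fun a c =>
          if a = i ∧ c = j then b else if a = i'' ∧ c = j then T i j else T a c))

/-- `IncBy M T T'`: `T'` is obtained from `T` by incrementing each box of the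
multiset `M` (with multiplicity). -/
inductive IncBy : Multiset (ℕ × ℕ) → (ℕ → ℕ → ℕ) → (ℕ → ℕ → ℕ) → Prop
  | nil (T : ℕ → ℕ → ℕ) : IncBy 0 T T
  | cons {M : Multiset (ℕ × ℕ)} {T T' T'' : ℕ → ℕ → ℕ} {i j : ℕ} :
      IncrementAt T T' i j → IncBy M T' T'' → IncBy ((i, j) ::ₘ M) T T''

/-- Column-injective tableau for `w`: a box has a nonzero entry iff it is an inversion
of `w`, and the nonzero entries in each column are distinct. -/
def ColInj {n : ℕ} (w : Equiv.Perm (Fin n)) (T : ℕ → ℕ → ℕ) : Prop :=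
  (∀ i j, T i j ≠ 0 ↔ IsInv w i j) ∧
  ∀ i i' j, 1 ≤ i → i < i' → i' < j → T i j ≠ 0 → T i' j ≠ 0 → T i j ≠ T i' j

/-- The Λ-shape `Λ(i,j,k)` is balanced in `T`. -/
def LBal (T : ℕ → ℕ → ℕ) (i j k : ℕ) : Prop :=
  min (T i j) (T j k) ≤ T i k ∧ T i k ≤ max (T i j) (T j k)

/-- Every Λ-shape of `Δ_{n-1}` is balanced in `T`. -/
def BalancedTab (n : ℕ) (T : ℕ → ℕ → ℕ) : Prop :=
  ∀ i j k, 1 ≤ i → i < j → j < k → k ≤ n → LBal T i j k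

/-- Inversions tableau for `w`: balanced column-injective tableau whose entries in
row `i` are at most `i`. -/
def InvTab {n : ℕ} (w : Equiv.Perm (Fin n)) (T : ℕ → ℕ → ℕ) : Prop :=
  ColInj w T ∧ BalancedTab n T ∧ ∀ i j, T i j ≤ i

/-- The multiset of entries of `T` on `hook(i,k)`. -/
def hookEntries (T : ℕ → ℕ → ℕ) (i k : ℕ) : Multiset ℕ :=
  (T i k ::ₘ (Finset.Ioo i k).val.map fun r => T r k) +
    (Finset.Ioo i k).val.map fun c => T i c

/-- The median ((k-i)-th smallest of the `2(k-i)-1` entries) of the hook of `(i,k)`. -/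
def hookMedian (T : ℕ → ℕ → ℕ) (i k : ℕ) : ℕ :=
  ((hookEntries T i k).sort (· ≤ ·)).getD (k - i - 1) 0

/-! ## Pipe dreams

A pipe dream in the staircase `Δ_n` is encoded by `P : ℕ → ℕ → Bool`, where
`P i j = true` means box `(i,j)` (row `i` from the top, column `j` from the left,
with `1 ≤ i, j` and `i + j ≤ n`) is a cross tile, and `false` means a bump tile;
boxes on the southeast boundary (`i + j = n + 1`) are elbow tiles. -/

/-- `labels n P i j` is the pair (label of the north edge, label of the east edge) of
the pipes passing through box `(i,j)`:  pipes enter at row `k` on the west side with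
label `k` and propagate through cross, bump and elbow tiles. -/
def labels (n : ℕ) (P : ℕ → ℕ → Bool) (i j : ℕ) : ℕ × ℕ :=
  let west := if _h1 : j ≤ 1 then i else (labels n P i (j - 1)).2
  if _h : i + j ≤ n then
    if P i j then ((labels n P (i + 1) j).1, west)
    else (west, (labels n P (i + 1) j).1)
  else (west, west)
termination_by (n + 1 - i) + j
decreasing_by all_goals omega

def northLabel (n : ℕ) (P : ℕ → ℕ → Bool) (i j : ℕ) : ℕ := (labels n P i j).1

def westLabel (n : ℕ) (P : ℕ → ℕ → Bool) (i j : ℕ) : ℕ :=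
  if j ≤ 1 then i else (labels n P i (j - 1)).2

def southLabel (n : ℕ) (P : ℕ → ℕ → Bool) (i j : ℕ) : ℕ := (labels n P (i + 1) j).1

/-- Pipes `p` and `q` cross at box `(i,j)` of `P`. -/
def CrossAt (n : ℕ) (P : ℕ → ℕ → Bool) (i j p q : ℕ) : Prop :=
  1 ≤ i ∧ 1 ≤ j ∧ i + j ≤ n ∧ P i j = true ∧
    ((westLabel n P i j = p ∧ southLabel n P i j = q) ∨
      (westLabel n P i j = q ∧ southLabel n P i j = p))

/-- `P` is a pipe dream for `w`: crosses lie in the staircase, and reading the pipe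
labels along the north side gives the one-line notation of `w`. -/
def IsPD {n : ℕ} (w : Equiv.Perm (Fin n)) (P : ℕ → ℕ → Bool) : Prop :=
  (∀ i j, P i j = true → 1 ≤ i ∧ 1 ≤ j ∧ i + j ≤ n) ∧
    ∀ j, 1 ≤ j → j ≤ n → northLabel n P 1 j = permVal w j

/-- `P` is reduced: no two pipes cross more than once. -/
def Reduced (n : ℕ) (P : ℕ → ℕ → Bool) : Prop :=
  ∀ p q i j i' j', CrossAt n P i j p q → CrossAt n P i' j' p q → i = i' ∧ j = j'

/-- The set of reduced pipe dreams for `w`. -/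
def RPD {n : ℕ} (w : Equiv.Perm (Fin n)) :=
  { P : ℕ → ℕ → Bool // IsPD w P ∧ Reduced n P }

/-- `R` is a rectangle (rows `a < b`, columns `c < d`) in which a chute move of `P`
can take place: `NW(R)=(a,c)` and `SW(R)=(b,c)` are bumps, `SE(R)=(b,d)` is a bump or
elbow, and all other boxes of `R` are crosses. -/
def IsChuteRect (n : ℕ) (P : ℕ → ℕ → Bool) (a b c d : ℕ) : Prop :=
  1 ≤ a ∧ a < b ∧ 1 ≤ c ∧ c < d ∧ b + d ≤ n + 1 ∧
    P a c = false ∧ P b c = false ∧ P b d = false ∧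
    ∀ i j, a ≤ i → i ≤ b → c ≤ j → j ≤ d →
      ¬(i = a ∧ j = c) → ¬(i = b ∧ j = c) → ¬(i = b ∧ j = d) → P i j = true

/-- The result of the chute move in the rectangle with corners `(a,c)`, `(b,d)`:
the bump at `SW=(b,c)` becomes a cross and the cross at `NE=(a,d)` becomes a bump. -/
def chuteResult (P : ℕ → ℕ → Bool) (a b c d : ℕ) : ℕ → ℕ → Bool :=
  fun i j => if i = b ∧ j = c then true else if i = a ∧ j = d then false else P i j

/-- `P'` is obtained from `P` by a single chute move. -/
def ChuteStep (n : ℕ) (P P' : ℕ → ℕ → Bool) : Prop :=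
  ∃ a b c d, IsChuteRect n P a b c d ∧ P' = chuteResult P a b c d

/-- The chute move order on `RPD w`: `P ≤ Q` iff `Q` is obtained from `P`
by a sequence of chute moves. -/
def chuteLE {n : ℕ} (w : Equiv.Perm (Fin n)) (P Q : RPD w) : Prop :=
  Relation.ReflTransGen (fun X Y : RPD w => ChuteStep n X.1 Y.1) P Q

/-- `theta n P p q` is the index of the row in which pipes `p` and `q` cross in `P`
(`0` if they do not cross).  For `P ∈ PD(w)` reduced, `theta n P` is the inversions
tableau `Θ(P)`. -/
def theta (n : ℕ) (P : ℕ → ℕ → Bool) (p q : ℕ) : ℕ :=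
  if h : ∃ rc : ℕ × ℕ, CrossAt n P rc.1 rc.2 p q then (Classical.choose h).1 else 0

/-- The Lehmer tableau `Φ(P) = Λ(Θ(P))` of a pipe dream. -/
def phi (n : ℕ) (P : ℕ → ℕ → Bool) (i j : ℕ) : ℕ := lehmer (theta n P) i j

/-- Cover relation of the chute move order. -/
def chuteCovBy {n : ℕ} (w : Equiv.Perm (Fin n)) (P Q : RPD w) : Prop :=
  chuteLE w P Q ∧ P ≠ Q ∧ ∀ R, chuteLE w P R → chuteLE w R Q → R = P ∨ R = Q

/-- The interval `[P, Q]` in the chute move order. -/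
def chuteIcc {n : ℕ} (w : Equiv.Perm (Fin n)) (P Q : RPD w) : Set (RPD w) :=
  { R | chuteLE w P R ∧ chuteLE w R Q }

/-- A chain in the chute move order. -/
def chuteChain {n : ℕ} (w : Equiv.Perm (Fin n)) (C : Set (RPD w)) : Prop :=
  ∀ x ∈ C, ∀ y ∈ C, chuteLE w x y ∨ chuteLE w y x

/-- `[P,Q]` is a polygon: an interval of cardinality at least 4 that is the union of
two chains whose intersection is `{P, Q}`. -/
def IsPolygon {n : ℕ} (w : Equiv.Perm (Fin n)) (P Q : RPD w) : Prop :=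
  chuteLE w P Q ∧ 4 ≤ (chuteIcc w P Q).ncard ∧
    ∃ C₁ C₂ : Set (RPD w), chuteChain w C₁ ∧ chuteChain w C₂ ∧
      C₁ ∪ C₂ = chuteIcc w P Q ∧ C₁ ∩ C₂ = {P, Q}

/-- `m` is the meet (greatest lower bound) of `P` and `Q` in the chute move order. -/
def IsMeetOf {n : ℕ} (w : Equiv.Perm (Fin n)) (m P Q : RPD w) : Prop :=
  chuteLE w m P ∧ chuteLE w m Q ∧ ∀ r, chuteLE w r P → chuteLE w r Q → chuteLE w r m

/-- `s` is the join (least upper bound) of `P` and `Q` in the chute move order. -/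
def IsJoinOf {n : ℕ} (w : Equiv.Perm (Fin n)) (s P Q : RPD w) : Prop :=
  chuteLE w P s ∧ chuteLE w Q s ∧ ∀ r, chuteLE w P r → chuteLE w Q r → chuteLE w s r

namespace PipeDream

/-! ### Trajectories of pipes -/

/-- The column in which a pipe leaves a row (with crosses `r`) through the north side, if it
enters that row from the south in column `s`, or from the west side if `s = 0`. -/
def step (r : ℕ → Bool) (s : ℕ) : ℕ := if r s then s else sInf {j | s < j ∧ r j = false}

/-- The column in which pipe `v` leaves row `i` through the north side, and `0` if `v < i`. -/
def col (P : ℕ → ℕ → Bool) (i v : ℕ) : ℕ :=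
  if i ≤ v then step (P i) (col P (i + 1) v) else 0
termination_by v + 1 - i

/-- All crosses lie in the staircase. -/
def Supp (n : ℕ) (P : ℕ → ℕ → Bool) : Prop :=
  ∀ i j, P i j = true → 1 ≤ i ∧ 1 ≤ j ∧ i + j ≤ n

/-- Two pipes that have crossed stay crossed. -/
def Persist (n : ℕ) (P : ℕ → ℕ → Bool) : Prop :=
  ∀ x y i, x < y → y ≤ n → 1 ≤ i → col P (i + 1) y < col P (i + 1) x → col P i y < col P i x

theorem step_of_true {r : ℕ → Bool} {s : ℕ} (h : r s = true) : step r s = s := by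
  simp [step, h]

theorem step_spec {r : ℕ → Bool} {N : ℕ} (hr : ∀ j, N ≤ j → r j = false) {s : ℕ}
    (h : r s = false) :
    s < step r s ∧ r (step r s) = false ∧ ∀ k, s < k → k < step r s → r k = true := by
  have hne : {j | s < j ∧ r j = false}.Nonempty := ⟨max N (s + 1), by simp, hr _ (by simp)⟩
  have h1 : step r s = sInf {j | s < j ∧ r j = false} := by simp [step, h]
  have h2 := Nat.sInf_mem hne
  rw [← h1] at h2
  refine ⟨h2.1, h2.2, fun k hk hk' => ?_⟩
  by_contra hc
  have := Nat.sInf_le (show k ∈ {j | s < j ∧ r j = false} from ⟨hk, by simpa using hc⟩)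
  omega

theorem step_eq {r : ℕ → Bool} {s t : ℕ} (h : r s = false) (hst : s < t) (ht : r t = false)
    (hk : ∀ k, s < k → k < t → r k = true) : step r s = t := by
  have h1 : step r s = sInf {j | s < j ∧ r j = false} := by simp [step, h]
  have hm : t ∈ {j | s < j ∧ r j = false} := ⟨hst, ht⟩
  have h2 := Nat.sInf_mem ⟨t, hm⟩
  have h3 := Nat.sInf_le hm
  rw [← h1] at h2 h3
  by_contra hc
  have := hk _ h2.1 (by omega)
  simp [h2.2] at this

theorem step_injective {r : ℕ → Bool} {N : ℕ} (hr : ∀ j, N ≤ j → r j = false) :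
    Function.Injective (step r) := by
  intro s t hst
  rcases hs : r s with _ | _ <;> rcases ht : r t with _ | _
  · have h1 := step_spec hr hs
    have h2 := step_spec hr ht
    rcases lt_trichotomy s t with h | h | h
    · have := h1.2.2 t h (by omega); simp_all
    · exact h
    · have := h2.2.2 s h (by omega); simp_all
  · have h1 := step_spec hr hs
    rw [step_of_true ht] at hst
    simp_all
  · have h1 := step_spec hr ht
    rw [step_of_true hs] at hst
    simp_all
  · rwa [step_of_true hs, step_of_true ht] at hst

theorem col_of_lt {P : ℕ → ℕ → Bool} {i v : ℕ} (h : v < i) : col P i v = 0 := by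
  rw [col]; simp; omega

theorem col_of_le {P : ℕ → ℕ → Bool} {i v : ℕ} (h : i ≤ v) :
    col P i v = step (P i) (col P (i + 1) v) := by
  rw [col]; simp [h]

section
variable {n : ℕ} {P : ℕ → ℕ → Bool}

theorem Supp.eq_false (hP : Supp n P) {i j : ℕ} (h : i = 0 ∨ j = 0 ∨ n < i + j) :
    P i j = false := by
  by_contra hc
  have := hP i j (by simpa using hc)
  omega

theorem Supp.row (hP : Supp n P) (i : ℕ) : ∀ j, n ≤ j → P i j = false := by
  intro j hj
  by_contra hc
  have := hP i j (by simpa using hc)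
  omega

theorem Supp.col_pos (hP : Supp n P) {i v : ℕ} (h : i ≤ v) : 0 < col P i v := by
  rw [col_of_le h]
  rcases hs : P i (col P (i + 1) v) with _ | _
  · have := (step_spec (hP.row i) hs).1; omega
  · rw [step_of_true hs]; exact (hP _ _ hs).2.1

theorem Supp.col_eq_zero (hP : Supp n P) {i v : ℕ} : col P i v = 0 ↔ v < i := by
  refine ⟨fun h => ?_, col_of_lt⟩
  by_contra hc
  have := hP.col_pos (i := i) (v := v) (by omega)
  omega

theorem Supp.col_le (hP : Supp n P) {v : ℕ} (hv : v ≤ n) : ∀ k i : ℕ, n + 1 = i + k →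
    col P i v ≤ k := by
  intro k
  induction k with
  | zero => intro i hi; rw [col_of_lt (by omega)]
  | succ k ih =>
    intro i hi
    have h1 := ih (i + 1) (by omega)
    by_cases hiv : i ≤ v
    · rw [col_of_le hiv]
      rcases hs : P i (col P (i + 1) v) with _ | _
      · have h2 := step_spec (hP.row i) hs
        by_contra hc
        have h3 := h2.2.2 (k + 1) (by omega) (by omega)
        have := hP _ _ h3
        omega
      · rw [step_of_true hs]; omega
    · rw [col_of_lt (by omega)]; omega

theorem Supp.col_injective (hP : Supp n P) {u v : ℕ} (hu : u ≤ n) :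
    ∀ k i : ℕ, n + 1 = i + k → 0 < col P i u → col P i u = col P i v → u = v := by
  intro k
  induction k with
  | zero => intro i hi h0; rw [col_of_lt (by omega)] at h0; omega
  | succ k ih =>
    intro i hi h0 he
    have hiu : i ≤ u := by by_contra hc; rw [col_of_lt (by omega)] at h0; omega
    have hiv : i ≤ v := by
      by_contra hc; rw [he, col_of_lt (by omega)] at h0; omega
    rw [col_of_le hiu, col_of_le hiv] at he
    have he := step_injective (hP.row i) he
    rcases Nat.eq_zero_or_pos (col P (i + 1) u) with hz | hz
    · have h1 := hP.col_eq_zero.1 hz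
      have h2 := hP.col_eq_zero.1 (he ▸ hz)
      omega
    · exact ih (i + 1) (by omega) hz he

theorem Supp.col_inj (hP : Supp n P) {i u v : ℕ} (hu : u ≤ n)
    (h0 : 0 < col P i u) (he : col P i u = col P i v) : u = v := by
  have : i ≤ u := by by_contra hc; rw [col_of_lt (by omega)] at h0; omega
  exact hP.col_injective hu (n + 1 - i) i (by omega) h0 he

/-- The horizontal segment that reaches column `j` in a row starts at `s`. -/
theorem exists_last_false (r : ℕ → Bool) (h0 : r 0 = false) :
    ∀ j, 0 < j → ∃ s, s < j ∧ r s = false ∧ ∀ k, s < k → k < j → r k = true := by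
  intro j
  induction j with
  | zero => intro h; omega
  | succ j ih =>
    intro _
    rcases hj : r j with _ | _
    · exact ⟨j, by omega, hj, fun k h1 h2 => by omega⟩
    · have : 0 < j := by
        rcases Nat.eq_zero_or_pos j with h | h
        · subst h; simp_all
        · exact h
      obtain ⟨s, h1, h2, h3⟩ := ih this
      refine ⟨s, by omega, h2, fun k hk hk' => ?_⟩
      rcases Nat.lt_succ_iff_lt_or_eq.1 hk' with h | h
      · exact h3 k hk h
      · rw [h]; exact hj

theorem Supp.exists_col (hP : Supp n P) : ∀ k i j : ℕ, n + 1 = i + k → 1 ≤ j → j ≤ k → 1 ≤ i →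
    ∃ v, i ≤ v ∧ v ≤ n ∧ col P i v = j := by
  intro k
  induction k with
  | zero => intros; omega
  | succ k ih =>
    intro i j hi hj hjk h1
    rcases hs : P i j with _ | _
    · obtain ⟨s, hsj, hs0, hsk⟩ := exists_last_false (P i) (hP.eq_false (by omega)) j hj
      have hst := step_eq hs0 hsj hs hsk
      rcases Nat.eq_zero_or_pos s with hz | hz
      · refine ⟨i, le_rfl, by omega, ?_⟩
        rw [col_of_le le_rfl, col_of_lt (by omega), ← hst, hz]
      · obtain ⟨v, h2, h3, h4⟩ := ih (i + 1) s (by omega) hz (by omega) (by omega)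
        exact ⟨v, by omega, h3, by rw [col_of_le (by omega), h4, hst]⟩
    · have := hP _ _ hs
      obtain ⟨v, h2, h3, h4⟩ := ih (i + 1) j (by omega) hj (by omega) (by omega)
      exact ⟨v, by omega, h3, by rw [col_of_le (by omega), h4, step_of_true hs]⟩

/-- The pipe that runs horizontally into column `j` of row `i`. -/
theorem Supp.exists_horizontal (hP : Supp n P) {i j : ℕ} (hi : 1 ≤ i) (hj : 1 ≤ j)
    (hij : i + j ≤ n + 1) :
    ∃ v, i ≤ v ∧ v ≤ n ∧ col P (i + 1) v < j ∧ P i (col P (i + 1) v) = false ∧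
      ∀ k, col P (i + 1) v < k → k < j → P i k = true := by
  obtain ⟨s, hsj, hs0, hsk⟩ := exists_last_false (P i) (hP.eq_false (by omega)) j hj
  rcases Nat.eq_zero_or_pos s with hz | hz
  · have hc : col P (i + 1) i = 0 := col_of_lt (by omega)
    exact ⟨i, le_rfl, by omega, by rw [hc]; omega, by rw [hc, ← hz]; exact hs0,
      fun k hk => hsk k (by omega)⟩
  · obtain ⟨v, h2, h3, h4⟩ := hP.exists_col (n - i) (i + 1) s (by omega) hz (by omega) (by omega)
    refine ⟨v, by omega, h3, by omega, by rw [h4]; exact hs0, fun k hk => hsk k (by omega)⟩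

end

/-! ### Crossing rows -/

theorem step_flip {r : ℕ → Bool} {N : ℕ} (hr : ∀ j, N ≤ j → r j = false) {s t : ℕ} (hst : s < t)
    (h : step r t < step r s) :
    r s = false ∧ r t = true ∧ step r t = t ∧ ∀ k, s < k → k < step r s → r k = true := by
  have hle : t ≤ step r t := by
    rcases ht : r t with _ | _
    · exact (step_spec hr ht).1.le
    · rw [step_of_true ht]
  rcases hs : r s with _ | _
  · have h1 := step_spec hr hs
    have h2 := h1.2.2 t hst (by omega)
    exact ⟨rfl, h2, step_of_true h2, h1.2.2⟩
  · rw [step_of_true hs] at h; omega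

/-- The row in which the pipes `x` and `y` cross, and `0` if they do not cross. -/
def crossRow (n : ℕ) (P : ℕ → ℕ → Bool) (x y : ℕ) : ℕ :=
  Nat.findGreatest (fun i => col P i y < col P i x) n

/-- The balance and injectivity conditions satisfied by the crossing rows. -/
structure Tab (n : ℕ) (T : ℕ → ℕ → ℕ) : Prop where
  inj : ∀ x y z, x < y → y < z → z ≤ n → T x z ≠ 0 → T x z ≠ T y z
  lo : ∀ x y z, x < y → y < z → z ≤ n → min (T x y) (T y z) ≤ T x z
  hi : ∀ x y z, x < y → y < z → z ≤ n → T x z ≤ max (T x y) (T y z)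

section
variable {n : ℕ} {P : ℕ → ℕ → Bool}

theorem le_crossRow_iff (hp : Persist n P) {x y i : ℕ} (hxy : x < y) (hy : y ≤ n)
    (hi : 1 ≤ i) : i ≤ crossRow n P x y ↔ col P i y < col P i x := by
  constructor
  · intro h
    have h1 : col P (crossRow n P x y) y < col P (crossRow n P x y) x :=
      Nat.findGreatest_of_ne_zero (P := fun i => col P i y < col P i x) rfl (by
        omega)
    refine Nat.decreasingInduction' (P := fun i => col P i y < col P i x) ?_ h h1
    intro k hk hk' ih
    exact hp x y k hxy hy (by omega) ih
  · intro h
    refine Nat.le_findGreatest ?_ h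
    by_contra hc
    rw [col_of_lt (v := x) (by omega)] at h
    omega

theorem crossRow_ne_zero_iff (hp : Persist n P) {x y : ℕ} (hxy : x < y)
    (hy : y ≤ n) : crossRow n P x y ≠ 0 ↔ col P 1 y < col P 1 x := by
  rw [← le_crossRow_iff hp hxy hy le_rfl]; omega

theorem crossRow_eq_iff (hp : Persist n P) {x y i : ℕ} (hxy : x < y) (hy : y ≤ n)
    (hi : 1 ≤ i) : crossRow n P x y = i ↔
      col P i y < col P i x ∧ col P (i + 1) x ≤ col P (i + 1) y := by
  have h1 := le_crossRow_iff hp hxy hy hi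
  have h2 := le_crossRow_iff hp (i := i + 1) hxy hy (by omega)
  omega

theorem tab_crossRow (hP : Supp n P) (hp : Persist n P) : Tab n (crossRow n P) where
  inj := by
    intro x y z hxy hyz hz h0 he
    obtain ⟨t, ht⟩ : ∃ t, crossRow n P x z = t := ⟨_, rfl⟩
    rw [ht] at h0 he
    obtain ⟨h1, h2⟩ := (crossRow_eq_iff hp (by omega) hz (by omega)).1 ht
    obtain ⟨h3, h4⟩ := (crossRow_eq_iff hp (by omega) hz (by omega)).1 he.symm
    have htx : t ≤ x := by
      by_contra hc
      rw [col_of_lt (v := x) (by omega)] at h1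
      omega
    have hz0 := hP.col_pos (i := t + 1) (v := z) (by omega)
    have h2' : col P (t + 1) x < col P (t + 1) z := by
      refine lt_of_le_of_ne h2 fun h => ?_
      have := hP.col_inj (by omega) (by omega) h
      omega
    have h4' : col P (t + 1) y < col P (t + 1) z := by
      refine lt_of_le_of_ne h4 fun h => ?_
      have := hP.col_inj (by omega) (by omega) h
      omega
    have hne : col P t x ≠ col P t y := fun h => by
      have := hP.col_inj (by omega) (by omega) h
      omega
    rw [col_of_le (v := x) (by omega), col_of_le (v := y) (by omega)] at hne
    rw [col_of_le (v := x) (by omega), col_of_le (v := z) (by omega)] at h1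
    rw [col_of_le (v := y) (by omega), col_of_le (v := z) (by omega)] at h3
    obtain ⟨a1, a2, a3, a4⟩ := step_flip (hP.row t) h2' h1
    obtain ⟨b1, b2, b3, b4⟩ := step_flip (hP.row t) h4' h3
    rcases lt_trichotomy (col P (t + 1) x) (col P (t + 1) y) with h | h | h
    · have := a4 _ h (by omega); simp_all
    · rw [h] at hne; exact hne rfl
    · have := b4 _ h (by omega); simp_all
  lo := by
    intro x y z hxy hyz hz
    rcases Nat.eq_zero_or_pos (min (crossRow n P x y) (crossRow n P y z)) with h | h
    · omega
    · have h1 := (le_crossRow_iff hp hxy (by omega) h).1 (min_le_left _ _)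
      have h2 := (le_crossRow_iff hp hyz hz h).1 (min_le_right _ _)
      exact (le_crossRow_iff hp (by omega) hz h).2 (by omega)
  hi := by
    intro x y z hxy hyz hz
    rcases Nat.eq_zero_or_pos (crossRow n P x z) with h | h
    · omega
    · have h1 := (le_crossRow_iff hp (by omega) hz h).1 le_rfl
      by_cases h2 : col P (crossRow n P x z) y < col P (crossRow n P x z) x
      · exact le_max_of_le_left ((le_crossRow_iff hp hxy (by omega) h).2 h2)
      · exact le_max_of_le_right ((le_crossRow_iff hp hyz hz h).2 (by omega))

end

/-! ### Lehmer entries -/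

/-- The number of `i < p` with `0 < T i y < t`. -/
def below (T : ℕ → ℕ → ℕ) (p y t : ℕ) : ℤ :=
  ∑ i ∈ Finset.range p, if 0 < T i y ∧ T i y < t then 1 else 0

/-- The number of `i < p` with `T i y ≠ 0`. -/
def support (T : ℕ → ℕ → ℕ) (p y : ℕ) : ℤ :=
  ∑ i ∈ Finset.range p, if T i y ≠ 0 then 1 else 0

/-- The Lehmer entry: the number of positive `k ≤ T x y` that do not occur below `(x, y)`. -/
def leh (T : ℕ → ℕ → ℕ) (x y : ℕ) : ℤ := T x y - below T x y (T x y)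

section
variable {n : ℕ} {T : ℕ → ℕ → ℕ}

theorem below_succ (T : ℕ → ℕ → ℕ) (p y t : ℕ) : below T p y (t + 1) =
    below T p y t + (((Finset.range p).filter fun i => 0 < t ∧ T i y = t).card : ℤ) := by
  rw [below, below, Finset.card_filter]
  push_cast
  rw [← Finset.sum_add_distrib]
  refine Finset.sum_congr rfl fun i _ => ?_
  split_ifs <;> omega

theorem Tab.hit_le_one (hT : Tab n T) {p y : ℕ} (hp : p ≤ y) (hy : y ≤ n) (t : ℕ) :
    ((Finset.range p).filter fun i => 0 < t ∧ T i y = t).card ≤ 1 := by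
  rw [Finset.card_le_one]
  intro a ha b hb
  simp only [Finset.mem_filter, Finset.mem_range] at ha hb
  rcases lt_trichotomy a b with h | h | h
  · exact absurd (ha.2.2.trans hb.2.2.symm) (hT.inj a b y h (by omega) hy (by omega))
  · exact h
  · exact absurd (hb.2.2.trans ha.2.2.symm) (hT.inj b a y h (by omega) hy (by omega))

theorem below_succ_of_hit (T : ℕ → ℕ → ℕ) {p y t i : ℕ} (hi : i < p) (h : T i y = t)
    (ht : t ≠ 0) : below T p y t + 1 ≤ below T p y (t + 1) := by
  rw [below_succ]
  have : 0 < ((Finset.range p).filter fun i => 0 < t ∧ T i y = t).card :=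
    Finset.card_pos.2 ⟨i, by simp; omega⟩
  omega

theorem below_of_hit (T : ℕ → ℕ → ℕ) {p y s t : ℕ} (hs : 0 < s) (hst : s ≤ t)
    (h : ∀ k, s ≤ k → k < t → ∃ i, i < p ∧ T i y = k) :
    below T p y s + (t - s) ≤ below T p y t := by
  induction t, hst using Nat.le_induction with
  | base => simp
  | succ k hk ih =>
    obtain ⟨i, hi, hT⟩ := h k hk (by omega)
    have g1 := below_succ_of_hit T hi hT (by omega)
    have g2 := ih fun k' h1 h2 => h k' h1 (by omega)
    push_cast
    omega

theorem Tab.below_mono (hT : Tab n T) {p y : ℕ} (hp : p ≤ y) (hy : y ≤ n) {t t' : ℕ}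
    (h : t ≤ t') : below T p y t' ≤ below T p y t + (t' - t) := by
  induction t', h using Nat.le_induction with
  | base => simp
  | succ k hk ih =>
    have := hT.hit_le_one hp hy k
    rw [below_succ]
    push_cast
    omega

theorem Tab.below_lt (hT : Tab n T) {x y : ℕ} (hxy : x < y) (hy : y ≤ n) {t' : ℕ}
    (h : T x y < t') :
    below T x y t' + 1 ≤ below T x y (T x y) + (t' - T x y) := by
  have h1 := hT.below_mono hxy.le hy (Nat.succ_le_of_lt h)
  have h2 : ((Finset.range x).filter fun i => 0 < T x y ∧ T i y = T x y).card = 0 := by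
    rw [Finset.card_eq_zero, Finset.filter_eq_empty_iff]
    intro i hi hc
    simp only [Finset.mem_range] at hi
    exact hT.inj i x y hi hxy hy (by omega) hc.2
  have h3 := below_succ T x y (T x y)
  push_cast at h1
  rw [Nat.succ_eq_add_one] at h1
  omega

/-- Comparison of two columns above the entry `T q r`. -/
theorem Tab.support_le (hT : Tab n T) {p q r t : ℕ} (hp : p ≤ q) (hq : q < r) (hr : r ≤ n)
    (ht : T q r < t) :
    support T p r - support T p q ≤ below T p r t - below T p q t := by
  rw [support, support, below, below, ← Finset.sum_sub_distrib, ← Finset.sum_sub_distrib]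
  refine Finset.sum_le_sum fun i hi => ?_
  simp only [Finset.mem_range] at hi
  have := hT.hi i q r (by omega) hq hr
  split_ifs <;> omega

/-- Comparison of two columns below the entry `T q r`. -/
theorem Tab.le_support (hT : Tab n T) {p q r t : ℕ} (hp : p ≤ q) (hq : q < r) (hr : r ≤ n)
    (h0 : 0 < t) (ht : t ≤ T q r) :
    below T p r t - below T p q t ≤ support T p r - support T p q := by
  rw [support, support, below, below, ← Finset.sum_sub_distrib, ← Finset.sum_sub_distrib]
  refine Finset.sum_le_sum fun i hi => ?_
  simp only [Finset.mem_range] at hi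
  have := hT.lo i q r (by omega) hq hr
  split_ifs <;> omega

theorem support_congr {S : ℕ → ℕ → ℕ} {p y : ℕ} (hpy : p ≤ y) (hy : y ≤ n)
    (h : ∀ x y, x < y → y ≤ n → (T x y = 0 ↔ S x y = 0)) : support T p y = support S p y := by
  refine Finset.sum_congr rfl fun i hi => ?_
  simp only [Finset.mem_range] at hi
  simp only [ne_eq, h i y (by omega) hy]

theorem below_split (T : ℕ → ℕ → ℕ) {p q y t : ℕ} (hpq : p < q) (hp : t ≤ T p y) :
    below T q y t = below T p y t +
      (((Finset.Ioo p q).filter fun i => 0 < T i y ∧ T i y < t).card : ℤ) := by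
  have h1 : below T q y t = below T (p + 1) y t +
      (((Finset.Ioo p q).filter fun i => 0 < T i y ∧ T i y < t).card : ℤ) := by
    rw [below, below, Finset.card_filter, ← Finset.sum_range_add_sum_Ico _ (by omega : p + 1 ≤ q)]
    push_cast
    congr 1
  rw [h1, below, Finset.sum_range_succ, below, if_neg (by omega : ¬ (0 < T p y ∧ T p y < t))]
  simp

theorem Tab.leh_lt_of_leh_lt {S : ℕ → ℕ → ℕ} (hT : Tab n T) (hS : Tab n S)
    (hz : ∀ x y, x < y → y ≤ n → (T x y = 0 ↔ S x y = 0))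
    (hle : ∀ x y, x < y → y ≤ n → leh T x y ≤ leh S x y)
    {p q r b : ℕ} (hpq : p < q) (hqr : q < r) (hr : r ≤ n) (hb0 : 0 < b)
    (hSpq : S p q = b) (hSpr : S p r = b) (hb : b < S q r)
    (hhit : ∀ k, b < k → k < S q r → ∃ h, h < q ∧ S h r = k)
    (hloc : ∀ i, p < i → i < q → S p i = b → ¬ b < S i r)
    (h1 : leh T p q < leh S p q) (h2 : leh T q r < leh S q r) : leh T p r < leh S p r := by
  by_contra hc
  have hpr := hpq.trans hqr
  have he : leh T p r = leh S p r := le_antisymm (hle p r hpr hr) (not_lt.1 hc)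
  have zu := hz p r hpr hr
  have zv := hz p q hpq (by omega)
  have zτ := hz q r hqr hr
  have dq : support T p q = support S p q := support_congr hpq.le (by omega) hz
  have dr : support T p r = support S p r := support_congr hpr.le hr hz
  have hJ := hS.le_support hpq.le hqr hr hb0 hb.le
  have hne : T p r ≠ T q r := hT.inj p q r hpq hqr hr (by omega)
  have hlo := hT.lo p q r hpq hqr hr
  have hhi := hT.hi p q r hpq hqr hr
  simp only [leh, hSpq, hSpr] at h1 h2 he
  rcases le_or_gt (T p r) (T p q) with huv | huv
  · have hm := hT.below_mono hpq.le (by omega) huv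
    by_cases hu : T q r < T p r
    · have := hT.support_le hpq.le hqr hr hu
      omega
    have huv' : T p q = T p r := by omega
    have : support T p r - support T p q ≤ below T p r (T p r) - below T p q (T p r) := by
      rw [support, support, below, below, ← Finset.sum_sub_distrib, ← Finset.sum_sub_distrib]
      refine Finset.sum_le_sum fun i hi => ?_
      simp only [Finset.mem_range] at hi
      have g1 := hT.inj i p r hi hpr hr
      have g2 := hT.hi i p r hi hpr hr
      have g3 := hT.lo i p q hi hpq (by omega)
      split_ifs <;> omega
    omega
  · have hτ : T p r < T q r := by omega
    have hex : ∃ i, p < i ∧ i < q ∧ 0 < T i r ∧ T i r < T p r ∧ b < S i r := by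
      by_contra hno
      push Not at hno
      have c1 := hT.below_mono (p := q) hqr.le hr hτ.le
      have c2 := below_split T (y := r) hpq (le_refl (T p r))
      have c3 := below_split S (y := r) (t := b) hpq hSpr.ge
      have c4 : ((Finset.Ioo p q).filter fun i => 0 < T i r ∧ T i r < T p r).card ≤
          ((Finset.Ioo p q).filter fun i => 0 < S i r ∧ S i r < b).card := by
        refine Finset.card_le_card fun i hi => ?_
        simp only [Finset.mem_filter, Finset.mem_Ioo] at hi ⊢
        have g1 := hno i hi.1.1 hi.1.2 hi.2.1 hi.2.2
        have g2 := hS.inj p i r hi.1.1 (by omega) hr (by omega)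
        have g3 := hz i r (by omega) hr
        omega
      have c5 : below S q r b + (S q r - b) ≤ below S q r (S q r) := by
        refine below_of_hit S hb0 hb.le fun k hk hk' => ?_
        rcases hk.eq_or_lt with h | h
        · exact ⟨p, hpq, by omega⟩
        · exact hhit k h hk'
      omega
    obtain ⟨i, hpi, hiq, hi0, hiu, hbi⟩ := hex
    have e1 := hT.hi p i r hpi (by omega) hr
    have e2 := hS.lo p i r hpi (by omega) hr
    have e3 := hle p i hpi (by omega)
    have e4 := hT.support_le hpi.le (by omega) hr hiu
    have e5 := hS.le_support hpi.le (by omega) hr hb0 hbi.le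
    have e6 : support T p i = support S p i := support_congr hpi.le (by omega) hz
    have e7 := hT.below_mono hpi.le (by omega) (show T p r ≤ T p i by omega)
    have e8 := hz p i hpi (by omega)
    have e9 : S p i < b := lt_of_le_of_ne (by omega) fun h => hloc i hpi hiq h hbi
    have e10 := hS.below_lt hpi (by omega) e9
    simp only [leh] at e3
    omega

end

/-! ### Trajectories and labels -/

/-- Pipe `v` enters the box `(i, j)` through its west side. -/
def Horiz (n : ℕ) (P : ℕ → ℕ → Bool) (i j v : ℕ) : Prop :=
  i ≤ v ∧ v ≤ n ∧ col P (i + 1) v < j ∧ P i (col P (i + 1) v) = false ∧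
    ∀ k, col P (i + 1) v < k → k < j → P i k = true

section
variable {n : ℕ} {P : ℕ → ℕ → Bool}

theorem Horiz.step_eq {i j v : ℕ} (h : Horiz n P i j v) (hj : P i j = false) : col P i v = j := by
  obtain ⟨h1, -, h3, h4, h5⟩ := h
  rw [col_of_le h1, PipeDream.step_eq h4 h3 hj h5]

theorem Horiz.lt_col (hP : Supp n P) {i j v : ℕ} (h : Horiz n P i j v) (hj : P i j = true) :
    j < col P i v := by
  obtain ⟨h1, -, h3, h4, h5⟩ := h
  rw [col_of_le h1]
  obtain ⟨a1, a2, a3⟩ := step_spec (hP.row i) h4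
  by_contra hc
  rcases (not_lt.1 hc).eq_or_lt with h | h
  · simp_all
  · have := h5 _ a1 h; simp_all

theorem Horiz.unique (hP : Supp n P) {i j v v' : ℕ} (h : Horiz n P i j v)
    (h' : Horiz n P i j v') : v = v' := by
  have h0 := hP.col_pos h.1
  refine hP.col_inj h.2.1 h0 ?_
  rw [col_of_le h.1, col_of_le h'.1]
  congr 1
  obtain ⟨-, -, h3, h4, h5⟩ := h
  obtain ⟨-, -, h3', h4', h5'⟩ := h'
  rcases lt_trichotomy (col P (i + 1) v) (col P (i + 1) v') with h | h | h
  · have := h5 _ h h3'; simp_all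
  · exact h
  · have := h5' _ h h3; simp_all

theorem labels_spec (hP : Supp n P) : ∀ m i j, n + 1 - i + j = m → 1 ≤ i → 1 ≤ j → i + j ≤ n + 1 →
    (i ≤ (labels n P i j).1 ∧ (labels n P i j).1 ≤ n ∧ col P i (labels n P i j).1 = j) ∧
      (i + j ≤ n → Horiz n P i (j + 1) (labels n P i j).2) ∧
      Horiz n P i j (westLabel n P i j) := by
  intro m
  induction m using Nat.strong_induction_on with
  | _ m ih =>
    intro i j hm hi hj hij
    have hW : Horiz n P i j (westLabel n P i j) := by
      rw [westLabel]
      split_ifs with h1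
      · have hc : col P (i + 1) i = 0 := col_of_lt (by omega)
        refine ⟨le_rfl, by omega, by omega, ?_, fun k hk hk' => by omega⟩
        rw [hc]; exact hP.eq_false (by omega)
      · have := (ih _ (by omega) i (j - 1) rfl hi (by omega) (by omega)).2.1 (by omega)
        rwa [Nat.sub_add_cancel hj] at this
    have hl : labels n P i j = if i + j ≤ n then
        (if P i j then ((labels n P (i + 1) j).1, westLabel n P i j)
          else (westLabel n P i j, (labels n P (i + 1) j).1))
        else (westLabel n P i j, westLabel n P i j) := by
      rw [labels]; rfl
    refine ⟨?_, ?_, hW⟩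
    · rw [hl]
      split_ifs with h1 h2
      · obtain ⟨⟨a1, a2, a3⟩, -⟩ := ih _ (by omega) (i + 1) j rfl (by omega) hj (by omega)
        refine ⟨by simp only; omega, a2, ?_⟩
        simp only
        rw [col_of_le (by omega), a3, step_of_true h2]
      · exact ⟨hW.1, hW.2.1, hW.step_eq (by simpa using h2)⟩
      · exact ⟨hW.1, hW.2.1, hW.step_eq (hP.eq_false (by omega))⟩
    · intro h1
      rw [hl, if_pos h1]
      split_ifs with h2
      · obtain ⟨b1, b2, b3, b4, b5⟩ := hW
        refine ⟨b1, b2, by simp only; omega, b4, fun k hk hk' => ?_⟩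
        rcases Nat.lt_succ_iff_lt_or_eq.1 hk' with h | h
        · exact b5 k hk h
        · rw [h]; exact h2
      · obtain ⟨⟨a1, a2, a3⟩, -⟩ := ih _ (by omega) (i + 1) j rfl (by omega) hj (by omega)
        refine ⟨by simp only; omega, a2, by simp only; omega, ?_, fun k hk hk' => ?_⟩
        · simp only; rw [a3]; simpa using h2
        · simp only at hk; omega

theorem horiz_westLabel (hP : Supp n P) {i j : ℕ} (hi : 1 ≤ i) (hj : 1 ≤ j) (h : i + j ≤ n + 1) :
    Horiz n P i j (westLabel n P i j) := (labels_spec hP _ i j rfl hi hj h).2.2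

theorem southLabel_spec (hP : Supp n P) {i j : ℕ} (hj : 1 ≤ j) (h : i + j ≤ n) :
    i + 1 ≤ southLabel n P i j ∧ southLabel n P i j ≤ n ∧ col P (i + 1) (southLabel n P i j) = j :=
  (labels_spec hP _ (i + 1) j rfl (by omega) hj (by omega)).1

theorem crossAt_of_flip (hP : Supp n P) {i h v : ℕ} (hi : 1 ≤ i) (hh : h ≤ n)
    (hih : i ≤ h) (h1 : col P (i + 1) h < col P (i + 1) v) (h2 : col P i v < col P i h) :
    CrossAt n P i (col P (i + 1) v) h v := by
  have hiv : i + 1 ≤ v := by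
    by_contra hc
    rw [col_of_lt (v := v) (by omega)] at h1
    omega
  rw [col_of_le hih, col_of_le (v := v) (by omega)] at h2
  obtain ⟨a1, a2, a3, a4⟩ := step_flip (hP.row i) h1 h2
  have hs := hP _ _ a2
  refine ⟨hi, hs.2.1, hs.2.2, a2, Or.inl ⟨?_, ?_⟩⟩
  · refine (horiz_westLabel hP hi hs.2.1 (by omega)).unique hP ⟨hih, hh, h1, a1, fun k hk hk' => ?_⟩
    exact a4 k hk (by omega)
  · obtain ⟨b1, b2, b3⟩ := southLabel_spec hP hs.2.1 hs.2.2
    exact hP.col_inj b2 (by omega) b3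

theorem Supp.persist_of_reduced (hP : Supp n P) (hr : Reduced n P) : Persist n P := by
  intro x y i hxy hy hi h
  by_contra hc
  have hix : i + 1 ≤ x := by
    by_contra hc
    rw [col_of_lt (v := x) (by omega)] at h
    omega
  have hne : col P i x ≠ col P i y := fun h => by
    have := hP.col_inj (by omega) (hP.col_pos (by omega)) h
    omega
  have h1 := crossAt_of_flip hP hi hy (by omega) h (by omega)
  have hT : i + 1 ≤ crossRow n P x y := Nat.le_findGreatest (by omega) h
  have hT1 : col P (crossRow n P x y) y < col P (crossRow n P x y) x :=
    Nat.findGreatest_of_ne_zero (P := fun i => col P i y < col P i x) rfl (by omega)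
  have hTx : crossRow n P x y ≤ x := by
    by_contra hc
    rw [col_of_lt (v := x) (by omega)] at hT1
    omega
  have hT2 : ¬ col P (crossRow n P x y + 1) y < col P (crossRow n P x y + 1) x := by
    exact Nat.findGreatest_is_greatest (P := fun i => col P i y < col P i x) (Nat.lt_succ_self _)
      (by omega)
  have hne : col P (crossRow n P x y + 1) y ≠ col P (crossRow n P x y + 1) x := fun h => by
    have := hP.col_inj hy (hP.col_pos (by omega)) h
    omega
  obtain ⟨c1, c2, c3, c4, c5⟩ :=
    crossAt_of_flip hP (by omega) (by omega) hTx (by omega) hT1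
  have := (hr _ _ _ _ _ _ h1 ⟨c1, c2, c3, c4, c5.symm⟩).1
  omega

theorem crossAt_spec (hP : Supp n P) (hp : Persist n P) {i j p q : ℕ} (h : CrossAt n P i j p q) :
    crossRow n P (min p q) (max p q) = i ∧ j = col P (i + 1) (max p q) := by
  obtain ⟨hi, hj, hij, hc, hl⟩ := h
  have hW := horiz_westLabel hP hi hj (by omega)
  obtain ⟨s1, s2, s3⟩ := southLabel_spec hP hj hij
  have h1 := hW.lt_col hP hc
  have h2 : col P i (southLabel n P i j) = j := by
    rw [col_of_le (by omega), s3, step_of_true hc]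
  have h3 := hW.2.2.1
  have hlt : westLabel n P i j < southLabel n P i j := by
    by_contra hge
    rcases (not_lt.1 hge).eq_or_lt with h | h
    · rw [← h] at h1; omega
    · have := hp _ _ i h hW.2.1 hi (by omega)
      omega
  have hT := (crossRow_eq_iff hp hlt s2 hi).2 (by omega)
  rcases hl with ⟨rfl, rfl⟩ | ⟨rfl, rfl⟩
  · rw [min_eq_left hlt.le, max_eq_right hlt.le]
    exact ⟨hT, s3.symm⟩
  · rw [min_eq_right hlt.le, max_eq_left hlt.le]
    exact ⟨hT, s3.symm⟩

theorem Persist.reduced (hP : Supp n P) (hp : Persist n P) : Reduced n P := by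
  intro p q i j i' j' h h'
  obtain ⟨h1, h2⟩ := crossAt_spec hP hp h
  obtain ⟨h3, h4⟩ := crossAt_spec hP hp h'
  obtain rfl : i = i' := h1.symm.trans h3
  exact ⟨rfl, h2.trans h4.symm⟩

/-- Reduced pipe dreams in terms of trajectories. -/
structure Good (w : Equiv.Perm (Fin n)) (P : ℕ → ℕ → Bool) : Prop where
  supp : Supp n P
  persist : Persist n P
  top : ∀ j, 1 ≤ j → j ≤ n → col P 1 (permVal w j) = j

theorem good_iff (w : Equiv.Perm (Fin n)) : Good w P ↔ IsPD w P ∧ Reduced n P := by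
  constructor
  · rintro ⟨h1, h2, h3⟩
    refine ⟨⟨h1, fun j hj hj' => ?_⟩, h2.reduced h1⟩
    obtain ⟨⟨a1, a2, a3⟩, -⟩ := labels_spec h1 _ 1 j rfl le_rfl hj (by omega)
    rw [northLabel]
    exact h1.col_inj a2 (by rw [a3]; omega) (a3.trans (h3 j hj hj').symm)
  · rintro ⟨⟨h1, h2⟩, h3⟩
    have h1 : Supp n P := h1
    refine ⟨h1, h1.persist_of_reduced h3, fun j hj hj' => ?_⟩
    obtain ⟨⟨a1, a2, a3⟩, -⟩ := labels_spec h1 _ 1 j rfl le_rfl hj (by omega)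
    rw [← h2 j hj hj']
    exact a3

theorem Good.col_one {w : Equiv.Perm (Fin n)} {R : ℕ → ℕ → Bool} (hP : Good w P) (hR : Good w R)
    {v : ℕ} (hv : v ≤ n) : col P 1 v = col R 1 v := by
  rcases Nat.eq_zero_or_pos v with h | h
  · rw [col_of_lt (by omega), col_of_lt (by omega)]
  · have h1 := hP.supp.col_pos h
    have h2 := hP.supp.col_le hv n 1 (by omega)
    have h3 := hP.top _ h1 h2
    have h4 := hP.supp.col_inj hv h1 h3.symm
    have h5 := hR.top _ h1 h2
    rw [← h4] at h5
    exact h5.symm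

theorem Good.crossRow_eq_zero_iff {w : Equiv.Perm (Fin n)} {R : ℕ → ℕ → Bool} (hP : Good w P)
    (hR : Good w R) (x y : ℕ) (hxy : x < y) (hy : y ≤ n) :
    crossRow n P x y = 0 ↔ crossRow n R x y = 0 := by
  have h1 := crossRow_ne_zero_iff hP.persist hxy hy
  have h2 := crossRow_ne_zero_iff hR.persist hxy hy
  rw [hP.col_one hR hy, hP.col_one hR (by omega), ← h2] at h1
  exact not_iff_not.1 h1

end

/-! ### Chute moves and trajectories -/

/-- The transposition of `c` and `d`. -/
def sw (c d j : ℕ) : ℕ := if j = c then d else if j = d then c else j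

theorem sw_sw {c d : ℕ} (j : ℕ) : sw c d (sw c d j) = j := by
  unfold sw; split_ifs <;> omega

theorem step_eq_of_agree {r r' : ℕ → Bool} {N : ℕ} (hr : ∀ j, N ≤ j → r j = false) {s : ℕ}
    (hs : r s = r' s) (h : ∀ k, s < k → k ≤ step r s → r k = r' k) : step r' s = step r s := by
  rcases h0 : r s with _ | _
  · obtain ⟨a1, a2, a3⟩ := step_spec hr h0
    refine step_eq (hs ▸ h0) a1 (by rw [← h _ a1 le_rfl, a2]) fun k hk hk' => ?_
    rw [← h k hk hk'.le]; exact a3 k hk hk'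
  · rw [step_of_true h0, step_of_true (hs ▸ h0)]

theorem step_le_of_false {r : ℕ → Bool} {N : ℕ} (hr : ∀ j, N ≤ j → r j = false) {s c : ℕ}
    (hsc : s < c) (hc : r c = false) : step r s ≤ c := by
  rcases h0 : r s with _ | _
  · by_contra h
    have := (step_spec hr h0).2.2 c hsc (by omega)
    simp_all
  · rw [step_of_true h0]; omega

theorem le_step {r : ℕ → Bool} {N : ℕ} (hr : ∀ j, N ≤ j → r j = false) (s : ℕ) :
    s ≤ step r s := by
  rcases h0 : r s with _ | _
  · exact (step_spec hr h0).1.le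
  · rw [step_of_true h0]

theorem step_eq_iff_of_true {r : ℕ → Bool} {N : ℕ} (hr : ∀ j, N ≤ j → r j = false) {s j : ℕ}
    (hj : r j = true) : step r s = j ↔ s = j := by
  constructor
  · intro h
    rcases h0 : r s with _ | _
    · have := (step_spec hr h0).2.1
      simp_all
    · rwa [step_of_true h0] at h
  · rintro rfl
    exact step_of_true hj

theorem step_bottom {r r' : ℕ → Bool} {N c d : ℕ} (hr : ∀ j, N ≤ j → r j = false)
    (hcd : c < d) (hc : r c = false) (hd : r d = false) (hm : ∀ k, c < k → k < d → r k = true)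
    (hc' : r' c = true) (hs : ∀ k, k ≠ c → r' k = r k) (s : ℕ) :
    step r' s = sw c d (step r s) := by
  rcases lt_trichotomy s c with h | h | h
  · have h1 := step_le_of_false hr h hc
    rcases h1.eq_or_lt with h2 | h2
    · have h0 : r s = false := by
        by_contra h0
        rw [step_of_true (by simpa using h0)] at h2
        omega
      obtain ⟨a1, a2, a3⟩ := step_spec hr h0
      rw [h2, sw, if_pos rfl]
      refine step_eq (by rw [hs _ (by omega), h0]) (by omega) (by rw [hs _ (by omega), hd])
        fun k hk hk' => ?_
      by_cases hkc : k = c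
      · rw [hkc, hc']
      · rw [hs _ hkc]
        rcases lt_or_gt_of_ne hkc with h | h
        · exact a3 k hk (by omega)
        · exact hm k h hk'
    · rw [sw, if_neg (by omega), if_neg (by omega)]
      exact step_eq_of_agree hr (hs _ (by omega)).symm fun k _ _ => (hs _ (by omega)).symm
  · subst h
    rw [step_of_true hc', step_eq hc hcd hd hm, sw, if_neg (by omega), if_pos rfl]
  · have h1 := le_step hr s
    have h2 : step r s ≠ d := by
      intro h2
      rcases h0 : r s with _ | _
      · obtain ⟨a1, a2, a3⟩ := step_spec hr h0
        have := hm s h (by omega)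
        simp_all
      · rw [step_of_true h0] at h2; simp_all
    rw [sw, if_neg (by omega), if_neg h2]
    exact step_eq_of_agree hr (hs _ (by omega)).symm fun k _ _ => (hs _ (by omega)).symm

theorem step_top {r r' : ℕ → Bool} {N c d : ℕ} (hr : ∀ j, N ≤ j → r j = false)
    (hcd : c < d) (hc : r c = false) (hd : r d = true) (hm : ∀ k, c < k → k < d → r k = true)
    (hd' : r' d = false) (hs : ∀ k, k ≠ d → r' k = r k) (s : ℕ) :
    step r' s = step r (sw c d s) := by
  rcases lt_trichotomy s c with h | h | h
  · have h1 := step_le_of_false hr h hc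
    rw [sw, if_neg (by omega), if_neg (by omega)]
    exact step_eq_of_agree hr (hs _ (by omega)).symm fun k _ _ => (hs _ (by omega)).symm
  · subst h
    rw [sw, if_pos rfl, step_of_true hd]
    refine step_eq (by rw [hs _ (by omega), hc]) hcd hd' fun k hk hk' => ?_
    rw [hs _ (by omega)]
    exact hm k hk hk'
  · by_cases hsd : s = d
    · subst hsd
      rw [sw, if_neg (by omega), if_pos rfl]
      obtain ⟨a1, a2, a3⟩ := step_spec hr hc
      have h1 : s < step r c := by
        by_contra hcon
        rcases (not_lt.1 hcon).eq_or_lt with h | h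
        · simp_all
        · have := hm _ a1 h
          simp_all
      refine step_eq hd' h1 (by rw [hs _ (by omega), a2]) fun k hk hk' => ?_
      rw [hs _ (by omega)]
      exact a3 k (by omega) hk'
    · rw [sw, if_neg (by omega), if_neg hsd]
      refine step_eq_of_agree hr (hs _ hsd).symm fun k hk hk' => (hs _ ?_).symm
      rintro rfl
      have h1 := hm s h hk
      rw [step_of_true h1] at hk'
      omega

theorem step_middle {r : ℕ → Bool} {N c d : ℕ} (hr : ∀ j, N ≤ j → r j = false)
    (hc : r c = true) (hd : r d = true) (s : ℕ) : step r (sw c d s) = sw c d (step r s) := by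
  have h1 := step_eq_iff_of_true hr (s := s) hc
  have h2 := step_eq_iff_of_true hr (s := s) hd
  by_cases hsc : s = c
  · rw [hsc, step_of_true hc, sw, if_pos rfl, step_of_true hd]
  · by_cases hsd : s = d
    · rw [hsd, step_of_true hd, sw, if_neg (by omega), if_pos rfl, step_of_true hc]
    · simp only [sw, h1, h2, hsc, hsd, if_false]

/-- `P'` is obtained from `P` by a chute move in rows `a < b` and columns `c < d`. -/
structure Chute (n : ℕ) (P P' : ℕ → ℕ → Bool) (a b c d : ℕ) : Prop where
  ha : 1 ≤ a
  hab : a < b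
  hc : 1 ≤ c
  hcd : c < d
  hn : b + d ≤ n + 1
  supp : Supp n P
  supp' : Supp n P'
  ac : P a c = false
  bc : P b c = false
  bd : P b d = false
  ad' : P' a d = false
  bc' : P' b c = true
  mid : ∀ i j, a ≤ i → i ≤ b → c ≤ j → j ≤ d →
    ¬(i = a ∧ j = c) → ¬(i = b ∧ j = c) → ¬(i = b ∧ j = d) → P i j = true
  same : ∀ i j, ¬(i = a ∧ j = d) → ¬(i = b ∧ j = c) → P' i j = P i j

section
variable {n a b c d : ℕ} {P P' : ℕ → ℕ → Bool}

theorem Chute.row_bottom (h : Chute n P P' a b c d) (s : ℕ) :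
    step (P' b) s = sw c d (step (P b) s) := by
  have := h.hab
  refine step_bottom (h.supp.row b) h.hcd h.bc h.bd (fun k hk hk' => ?_) h.bc' (fun k hk => ?_) s
  · exact h.mid b k (by omega) le_rfl hk.le hk'.le (by omega) (by omega) (by omega)
  · exact h.same _ _ (by omega) (by omega)

theorem Chute.row_top (h : Chute n P P' a b c d) (s : ℕ) :
    step (P' a) s = step (P a) (sw c d s) := by
  have := h.hab
  have := h.hcd
  refine step_top (h.supp.row a) h.hcd h.ac ?_ (fun k hk hk' => ?_) h.ad' (fun k hk => ?_) s
  · exact h.mid a d le_rfl (by omega) (by omega) le_rfl (by omega) (by omega) (by omega)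
  · exact h.mid a k le_rfl (by omega) hk.le hk'.le (by omega) (by omega) (by omega)
  · exact h.same _ _ (by omega) (by omega)

theorem Chute.row_middle (h : Chute n P P' a b c d) {i : ℕ} (hi : a < i) (hi' : i < b) (s : ℕ) :
    step (P' i) (sw c d s) = sw c d (step (P i) s) := by
  have := h.hcd
  have h1 : P' i = P i := funext fun j => h.same i j (by omega) (by omega)
  rw [h1]
  refine step_middle (h.supp.row i) ?_ ?_ s
  · exact h.mid i c (by omega) (by omega) le_rfl (by omega) (by omega) (by omega) (by omega)
  · exact h.mid i d (by omega) (by omega) (by omega) le_rfl (by omega) (by omega) (by omega)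

theorem Chute.row_other (h : Chute n P P' a b c d) {i : ℕ} (hi : i ≠ a) (hi' : i ≠ b) :
    P' i = P i := funext fun j => h.same i j (by omega) (by omega)

theorem Chute.col_eq (h : Chute n P P' a b c d) (v : ℕ) : ∀ k i, i + k = v + 1 →
    col P' i v = if a < i ∧ i ≤ b then sw c d (col P i v) else col P i v := by
  have h1 := h.hab
  have h2 := h.hcd
  have h3 := h.hc
  intro k
  induction k with
  | zero =>
    intro i hi
    rw [col_of_lt (by omega), col_of_lt (by omega)]
    simp only [sw]
    split_ifs <;> omega
  | succ k ih =>
    intro i hi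
    have ih := ih (i + 1) (by omega)
    rw [col_of_le (P := P') (by omega), col_of_le (P := P) (by omega), ih]
    rcases lt_trichotomy i b with hb | hb | hb
    · rcases lt_trichotomy i a with ha | ha | ha
      · rw [if_neg (by omega), if_neg (by omega), h.row_other (by omega) (by omega)]
      · subst ha
        rw [if_pos (by omega), if_neg (by omega), h.row_top, sw_sw]
      · rw [if_pos (by omega), if_pos (by omega), h.row_middle ha hb]
    · subst hb
      rw [if_neg (by omega), if_pos (by omega), h.row_bottom]
    · rw [if_neg (by omega), if_neg (by omega), h.row_other (by omega) (by omega)]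

theorem Chute.col_mid (h : Chute n P P' a b c d) {i : ℕ} (v : ℕ) (hi : a < i) (hi' : i ≤ b) :
    col P' i v = sw c d (col P i v) := by
  rcases le_or_gt i (v + 1) with h1 | h1
  · rw [h.col_eq v (v + 1 - i) i (by omega), if_pos ⟨hi, hi'⟩]
  · have := h.hcd
    have := h.hc
    rw [col_of_lt (by omega), col_of_lt (by omega)]
    simp only [sw]
    split_ifs <;> omega

theorem Chute.col_out (h : Chute n P P' a b c d) {i : ℕ} (v : ℕ) (hi : ¬ (a < i ∧ i ≤ b)) :
    col P' i v = col P i v := by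
  rcases le_or_gt i (v + 1) with h1 | h1
  · rw [h.col_eq v (v + 1 - i) i (by omega), if_neg hi]
  · rw [col_of_lt (by omega), col_of_lt (by omega)]

/-- Between the rows `a` and `b`, the pipes in the columns from `c` to `d` are vertical. -/
theorem Chute.vertical (h : Chute n P P' a b c d) {i j : ℕ} (v : ℕ) (hi : a < i) (hi' : i ≤ b)
    (hj : c ≤ j) (hj' : j ≤ d) : col P i v = j ↔ col P b v = j := by
  have h1 := h.hc
  induction hi' using Nat.decreasingInduction with
  | self => rfl
  | of_succ k hk ih =>
    refine Iff.trans ?_ (ih (by omega))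
    rcases le_or_gt k v with hv | hv
    · rw [col_of_le hv]
      exact step_eq_iff_of_true (h.supp.row k)
        (h.mid k j (by omega) (by omega) hj hj' (by omega) (by omega) (by omega))
    · rw [col_of_lt (by omega), col_of_lt (by omega)]

end

section
variable {n a b c d : ℕ} {P P' : ℕ → ℕ → Bool}

theorem Chute.top_c (h : Chute n P P' a b c d) {v : ℕ} (hv : col P (a + 1) v = c) :
    d < col P a v := by
  have := h.hc
  have := h.hab
  have h1 : a + 1 ≤ v := by
    by_contra hcon
    rw [col_of_lt (by omega)] at hv
    omega
  rw [col_of_le (by omega), hv]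
  obtain ⟨a1, a2, a3⟩ := step_spec (h.supp.row a) h.ac
  by_contra hcon
  have := h.mid a _ le_rfl (by omega) a1.le (not_lt.1 hcon) (by omega) (by omega) (by omega)
  simp_all

theorem Chute.top_mid (h : Chute n P P' a b c d) {v : ℕ} (hv : c < col P (a + 1) v)
    (hv' : col P (a + 1) v ≤ d) : col P a v = col P (a + 1) v := by
  have := h.hc
  have := h.hab
  have h1 : a + 1 ≤ v := by
    by_contra hcon
    rw [col_of_lt (by omega)] at hv
    omega
  rw [col_of_le (by omega)]
  exact step_of_true (h.mid a _ le_rfl (by omega) hv.le hv' (by omega) (by omega) (by omega))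

theorem Chute.bottom_mid (h : Chute n P P' a b c d) {v : ℕ} (hv : c < col P b v)
    (hv' : col P b v < d) : col P (b + 1) v = col P b v := by
  have := h.hc
  have := h.hab
  have h1 : b ≤ v := by
    by_contra hcon
    rw [col_of_lt (by omega)] at hv
    omega
  have h2 := h.mid b (col P b v) (by omega) le_rfl hv.le hv'.le (by omega) (by omega) (by omega)
  exact (step_eq_iff_of_true (h.supp.row b) h2).1 (col_of_le h1).symm

theorem Chute.bottom_c (h : Chute n P P' a b c d) {v : ℕ} (hv : col P b v = c) :
    col P (b + 1) v < c := by
  have h1 : b ≤ v := by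
    by_contra hcon
    have := h.hc
    rw [col_of_lt (by omega)] at hv
    omega
  rw [col_of_le h1] at hv
  rcases h0 : P b (col P (b + 1) v) with _ | _
  · have := (step_spec (h.supp.row b) h0).1
    omega
  · rw [step_of_true h0] at hv
    have := h.bc
    simp_all

theorem Chute.bottom_d (h : Chute n P P' a b c d) {v : ℕ} (hv : col P b v = d) :
    col P (b + 1) v = c := by
  have := h.hcd
  have := h.hab
  have h1 : b ≤ v := by
    by_contra hcon
    rw [col_of_lt (by omega)] at hv
    omega
  rw [col_of_le h1] at hv
  rcases h0 : P b (col P (b + 1) v) with _ | _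
  · have h2 := (step_spec (h.supp.row b) h0).1
    rcases lt_trichotomy (col P (b + 1) v) c with h3 | h3 | h3
    · have := step_le_of_false (h.supp.row b) h3 h.bc
      omega
    · exact h3
    · have := h.mid b _ (by omega) le_rfl h3.le (by omega) (by omega) (by omega) (by omega)
      simp_all
  · rw [step_of_true h0] at hv
    have := h.bd
    simp_all

theorem Chute.band (h : Chute n P P' a b c d) {i : ℕ} (hi : a < i) (hi' : i ≤ b) (v : ℕ)
    (hv : (c ≤ col P i v ∧ col P i v ≤ d) ∨ (c ≤ col P b v ∧ col P b v ≤ d)) :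
    col P i v = col P b v := by
  rcases hv with hv | hv
  · exact ((h.vertical v hi hi' hv.1 hv.2).1 rfl).symm
  · exact (h.vertical v hi hi' hv.1 hv.2).2 rfl

/-- The order of the pipes in the rectangle of a chute move. -/
structure ChuteOrd (n : ℕ) (P : ℕ → ℕ → Bool) (b c d : ℕ) : Prop where
  left : ∀ p y, p ≤ n → y ≤ n → col P b p = c → c < col P b y → col P b y ≤ d → p < y
  right : ∀ q r, q ≤ n → r ≤ n → col P b q = d → c < col P b r → col P b r < d → q < r

theorem Chute.ord (h : Chute n P P' a b c d) (hp : Persist n P) : ChuteOrd n P b c d where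
  left := by
    intro p y hpn hyn h1 h2 h3
    have hab := h.hab
    have hcd := h.hcd
    have b1 := h.band (i := a + 1) (by omega) hab p (by omega)
    have b2 := h.band (i := a + 1) (by omega) hab y (by omega)
    rw [← b1] at h1
    rw [← b2] at h2 h3
    have e1 := h.top_c h1
    have e2 := h.top_mid h2 h3
    by_contra hcon
    rcases (not_lt.1 hcon).eq_or_lt with he | he
    · rw [he] at h2; omega
    · have := hp y p a he hpn h.ha (by omega)
      omega
  right := by
    intro q r hqn hrn h1 h2 h3
    have e1 := h.bottom_d h1
    have e2 := h.bottom_mid h2 h3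
    have := h.ha
    have := h.hab
    by_contra hcon
    rcases (not_lt.1 hcon).eq_or_lt with he | he
    · rw [he] at h3; omega
    · have := hp r q b he hqn (by omega) (by omega)
      omega

theorem Chute.ord_of_result (h : Chute n P P' a b c d) (hp : Persist n P') :
    ChuteOrd n P b c d where
  left := by
    intro p y hpn hyn h1 h2 h3
    have hab := h.hab
    have hcd := h.hcd
    have ha := h.ha
    have e1 := h.bottom_c h1
    have e2 : c ≤ col P (b + 1) y := by
      rcases h3.eq_or_lt with h4 | h4
      · rw [h.bottom_d h4]
      · rw [h.bottom_mid h2 h4]; omega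
    by_contra hcon
    rcases (not_lt.1 hcon).eq_or_lt with he | he
    · rw [he] at h2; omega
    · have := hp y p b he hpn (by omega)
      rw [h.col_out _ (by omega), h.col_out _ (by omega), h.col_mid _ hab le_rfl,
        h.col_mid _ hab le_rfl, sw, sw] at this
      have := this (by omega)
      split_ifs at this <;> omega
  right := by
    intro q r hqn hrn h1 h2 h3
    have hab := h.hab
    have hcd := h.hcd
    have b1 := h.band (i := a + 1) (by omega) hab q (by omega)
    have b2 := h.band (i := a + 1) (by omega) hab r (by omega)
    rw [← b1] at h1
    rw [← b2] at h2 h3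
    have e1 := h.top_mid (v := q) (by omega) (by omega)
    have e2 := h.top_mid h2 h3.le
    by_contra hcon
    rcases (not_lt.1 hcon).eq_or_lt with he | he
    · rw [he] at h3; omega
    · have := hp r q a he hqn h.ha
      rw [h.col_mid _ (by omega) (by omega), h.col_mid _ (by omega) (by omega),
        h.col_out _ (by omega), h.col_out _ (by omega), sw, sw] at this
      have := this (by split_ifs <;> omega)
      omega

theorem sw_lt_iff {c d x y : ℕ} (hcd : c < d) (h : ¬ (c ≤ x ∧ x ≤ d ∧ c ≤ y ∧ y ≤ d)) :
    sw c d x < sw c d y ↔ x < y := by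
  unfold sw; split_ifs <;> omega

theorem sw_lt {c d x y : ℕ} (hcd : c < d) (h : x < y) (h1 : ¬ (x = c ∧ y ≤ d))
    (h2 : ¬ (y = d ∧ c ≤ x)) :
    sw c d x < sw c d y := by
  unfold sw; split_ifs <;> omega

theorem Chute.persist_result (h : Chute n P P' a b c d) (hp : Persist n P) : Persist n P' := by
  have ho := h.ord hp
  have ha := h.ha
  have hab := h.hab
  have hcd := h.hcd
  intro x y i hxy hy hi hinv
  by_cases hout : i < a ∨ b < i
  · rw [h.col_out _ (by omega), h.col_out _ (by omega)] at hinv ⊢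
    exact hp x y i hxy hy hi hinv
  by_cases hia : i = a
  · subst hia
    rw [h.col_mid _ (by omega) (by omega), h.col_mid _ (by omega) (by omega)] at hinv
    rw [h.col_out _ (by omega), h.col_out _ (by omega)]
    by_cases hlt : col P (i + 1) y < col P (i + 1) x
    · exact hp x y i hxy hy hi hlt
    have hcase : (col P (i + 1) x = c ∧ c < col P (i + 1) y ∧ col P (i + 1) y ≤ d) ∨
        (col P (i + 1) y = d ∧ c < col P (i + 1) x ∧ col P (i + 1) x < d) := by
      unfold sw at hinv
      split_ifs at hinv <;> omega
    rcases hcase with ⟨h1, h2, h3⟩ | ⟨h1, h2, h3⟩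
    · have := h.top_c h1
      have := h.top_mid h2 h3
      omega
    · have e1 := h.band (i := i + 1) (by omega) hab y (by omega)
      have e2 := h.band (i := i + 1) (by omega) hab x (by omega)
      have := ho.right y x hy (by omega) (by omega) (by omega) (by omega)
      omega
  by_cases hib : i = b
  · subst hib
    rw [h.col_out _ (by omega), h.col_out _ (by omega)] at hinv
    rw [h.col_mid _ (by omega) (by omega), h.col_mid _ (by omega) (by omega)]
    have hlt := hp x y i hxy hy hi hinv
    refine sw_lt hcd hlt ?_ ?_
    · rintro ⟨h1, h2⟩
      have := ho.left y x hy (by omega) h1 (by omega) h2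
      omega
    · rintro ⟨h1, h2⟩
      rcases h2.eq_or_lt with h3 | h3
      · have := ho.left y x hy (by omega) h3.symm (by omega) (by omega)
        omega
      · have e1 := h.bottom_d h1
        have e2 := h.bottom_mid h3 (by omega)
        omega
  · rw [h.col_mid _ (by omega) (by omega), h.col_mid _ (by omega) (by omega)] at hinv ⊢
    have ex := h.band (i := i + 1) (by omega) (by omega) x
    have ey := h.band (i := i + 1) (by omega) (by omega) y
    have ex' := h.band (i := i) (by omega) (by omega) x
    have ey' := h.band (i := i) (by omega) (by omega) y
    by_cases hb : c ≤ col P (i + 1) y ∧ col P (i + 1) y ≤ d ∧ c ≤ col P (i + 1) x ∧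
      col P (i + 1) x ≤ d
    · rwa [show col P i x = col P (i + 1) x by omega, show col P i y = col P (i + 1) y by omega]
    · rw [sw_lt_iff hcd hb] at hinv
      rw [sw_lt_iff hcd (by omega)]
      exact hp x y i hxy hy hi hinv

theorem Chute.persist_of_result (h : Chute n P P' a b c d) (hp : Persist n P') :
    Persist n P := by
  have ho := h.ord_of_result hp
  have ha := h.ha
  have hab := h.hab
  have hcd := h.hcd
  intro x y i hxy hy hi hinv
  have hp' := hp x y i hxy hy hi
  by_cases hout : i < a ∨ b < i
  · rw [h.col_out _ (by omega), h.col_out _ (by omega), h.col_out _ (by omega),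
      h.col_out _ (by omega)] at hp'
    exact hp' hinv
  by_cases hia : i = a
  · subst hia
    rw [h.col_mid _ (by omega) (by omega), h.col_mid _ (by omega) (by omega),
      h.col_out _ (by omega), h.col_out _ (by omega)] at hp'
    by_cases hlt : sw c d (col P (i + 1) y) < sw c d (col P (i + 1) x)
    · exact hp' hlt
    have hcase : (col P (i + 1) y = c ∧ c < col P (i + 1) x ∧ col P (i + 1) x ≤ d) ∨
        (col P (i + 1) x = d ∧ c < col P (i + 1) y ∧ col P (i + 1) y < d) := by
      unfold sw at hlt
      split_ifs at hlt <;> omega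
    have e1 := h.band (i := i + 1) (by omega) hab y (by omega)
    have e2 := h.band (i := i + 1) (by omega) hab x (by omega)
    rcases hcase with ⟨h1, h2, h3⟩ | ⟨h1, h2, h3⟩
    · have := ho.left y x hy (by omega) (by omega) (by omega) (by omega)
      omega
    · rw [h.top_mid h2 h3.le, h.top_mid (v := x) (by omega) (by omega)]
      omega
  by_cases hib : i = b
  · subst hib
    rw [h.col_out _ (by omega), h.col_out _ (by omega), h.col_mid _ (by omega) (by omega),
      h.col_mid _ (by omega) (by omega)] at hp'
    have hlt := hp' hinv
    by_contra hcon
    have hcase : (col P i x = c ∧ c < col P i y ∧ col P i y ≤ d) ∨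
        (col P i y = d ∧ c < col P i x ∧ col P i x < d) := by
      unfold sw at hlt
      split_ifs at hlt <;> omega
    rcases hcase with ⟨h1, h2, h3⟩ | ⟨h1, h2, h3⟩
    · have e1 := h.bottom_c h1
      rcases h3.eq_or_lt with h4 | h4
      · have := h.bottom_d h4
        omega
      · have := h.bottom_mid h2 h4
        omega
    · have := ho.right y x hy (by omega) h1 h2 h3
      omega
  · rw [h.col_mid _ (by omega) (by omega), h.col_mid _ (by omega) (by omega),
      h.col_mid _ (by omega) (by omega), h.col_mid _ (by omega) (by omega)] at hp'
    have ex := h.band (i := i + 1) (by omega) (by omega) x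
    have ey := h.band (i := i + 1) (by omega) (by omega) y
    have ex' := h.band (i := i) (by omega) (by omega) x
    have ey' := h.band (i := i) (by omega) (by omega) y
    by_cases hb : c ≤ col P (i + 1) y ∧ col P (i + 1) y ≤ d ∧ c ≤ col P (i + 1) x ∧
      col P (i + 1) x ≤ d
    · omega
    · rw [sw_lt_iff hcd hb, sw_lt_iff hcd (by omega)] at hp'
      exact hp' hinv

theorem Chute.good_result {w : Equiv.Perm (Fin n)} (h : Chute n P P' a b c d) (hP : Good w P) :
    Good w P' where
  supp := h.supp'
  persist := h.persist_result hP.persist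
  top j hj hj' := by rw [h.col_out _ (by have := h.ha; omega)]; exact hP.top j hj hj'

theorem Chute.good_of_result {w : Equiv.Perm (Fin n)} (h : Chute n P P' a b c d)
    (hP : Good w P') : Good w P where
  supp := h.supp
  persist := h.persist_of_result hP.persist
  top j hj hj' := by rw [← h.col_out (P' := P') _ (by have := h.ha; omega)]; exact hP.top j hj hj'

end

/-! ### Chute moves and crossing rows -/

/-- The pairs of pipes whose Lehmer entries are changed by a chute move. -/
def Changed (P : ℕ → ℕ → Bool) (b c d x y : ℕ) : Prop :=
  col P b x = c ∧ c < col P b y ∧ col P b y ≤ d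

section
variable {n a b c d : ℕ} {P P' : ℕ → ℕ → Bool}

theorem Chute.crossRow_left (h : Chute n P P' a b c d) (hp : Persist n P) {p y : ℕ} (hpn : p ≤ n)
    (hyn : y ≤ n) (h1 : col P b p = c) (h2 : c < col P b y) (h3 : col P b y ≤ d) :
    crossRow n P p y = a ∧ crossRow n P' p y = b := by
  have hab := h.hab
  have hcd := h.hcd
  have ha := h.ha
  have hlt := (h.ord hp).left p y hpn hyn h1 h2 h3
  have b1 := h.band (i := a + 1) (by omega) hab p (by omega)
  have b2 := h.band (i := a + 1) (by omega) hab y (by omega)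
  constructor
  · rw [crossRow_eq_iff hp hlt hyn ha, h.top_mid (v := y) (by omega) (by omega)]
    have := h.top_c (v := p) (by omega)
    omega
  · rw [crossRow_eq_iff (h.persist_result hp) hlt hyn (by omega), h.col_mid _ hab le_rfl,
      h.col_mid _ hab le_rfl, h.col_out _ (by omega), h.col_out _ (by omega)]
    have e1 := h.bottom_c h1
    constructor
    · unfold sw; split_ifs <;> omega
    · rcases h3.eq_or_lt with h4 | h4
      · have := h.bottom_d h4; omega
      · have := h.bottom_mid h2 h4; omega

theorem Chute.crossRow_right (h : Chute n P P' a b c d) (hp : Persist n P) {q r : ℕ} (hqn : q ≤ n)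
    (hrn : r ≤ n) (h1 : col P b q = d) (h2 : c < col P b r) (h3 : col P b r < d) :
    crossRow n P q r = b ∧ crossRow n P' q r = a := by
  have hab := h.hab
  have hcd := h.hcd
  have ha := h.ha
  have hlt := (h.ord hp).right q r hqn hrn h1 h2 h3
  have b1 := h.band (i := a + 1) (by omega) hab q (by omega)
  have b2 := h.band (i := a + 1) (by omega) hab r (by omega)
  constructor
  · rw [crossRow_eq_iff hp hlt hrn (by omega), h.bottom_mid h2 h3, h.bottom_d h1]
    omega
  · rw [crossRow_eq_iff (h.persist_result hp) hlt hrn (by omega),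
      h.col_mid (i := a + 1) _ (by omega) (by omega),
      h.col_mid (i := a + 1) _ (by omega) (by omega), h.col_out (i := a) _ (by omega),
      h.col_out (i := a) _ (by omega), h.top_mid (v := r) (by omega) (by omega),
      h.top_mid (v := q) (by omega) (by omega)]
    refine ⟨by omega, ?_⟩
    unfold sw; split_ifs <;> omega

theorem Chute.crossRow_other (h : Chute n P P' a b c d) (hp : Persist n P) {x y : ℕ} (hxy : x < y)
    (hy : y ≤ n) (h1 : ¬ (col P b x = c ∧ c < col P b y ∧ col P b y ≤ d))
    (h2 : ¬ (col P b x = d ∧ c < col P b y ∧ col P b y < d)) :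
    crossRow n P' x y = crossRow n P x y := by
  have hcd := h.hcd
  have ho := h.ord hp
  have key : ∀ i, 1 ≤ i → (i ≤ crossRow n P' x y ↔ i ≤ crossRow n P x y) := by
    intro i hi
    rw [le_crossRow_iff hp hxy hy hi, le_crossRow_iff (h.persist_result hp) hxy hy hi]
    by_cases hm : a < i ∧ i ≤ b
    · rw [h.col_mid _ hm.1 hm.2, h.col_mid _ hm.1 hm.2]
      by_cases hb : c ≤ col P i y ∧ col P i y ≤ d ∧ c ≤ col P i x ∧ col P i x ≤ d
      · rw [h.band hm.1 hm.2 x (by omega), h.band hm.1 hm.2 y (by omega)]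
        rw [h.band hm.1 hm.2 x (by omega), h.band hm.1 hm.2 y (by omega)] at hb
        have g1 := ho.left y x hy (by omega)
        have g2 := ho.right y x hy (by omega)
        have g3 : col P b x ≠ col P b y := fun he => by
          have := h.supp.col_inj (by omega) (by have := h.hc; omega) he
          omega
        unfold sw
        split_ifs <;> omega
      · exact sw_lt_iff hcd hb
    · rw [h.col_out _ hm, h.col_out _ hm]
  have k1 := key (crossRow n P' x y)
  have k2 := key (crossRow n P x y)
  omega

/-- Every row strictly between the rows of a chute move is used by a pipe that crosses the
rectangle from west to east. -/
theorem Chute.exists_hit (h : Chute n P P' a b c d) (hp : Persist n P) {p k : ℕ} (hpn : p ≤ n)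
    (hpc : col P b p = c) (hk : a < k) (hk' : k < b) :
    ∃ g, g < p ∧ ∀ y, y ≤ n → c < col P b y → col P b y ≤ d →
      crossRow n P g y = k ∧ crossRow n P' g y = k := by
  have hc := h.hc
  have hcd := h.hcd
  have hn := h.hn
  obtain ⟨g, g1, g2, g3, g4, g5⟩ := h.supp.exists_horizontal (i := k) (by omega) hc (by omega)
  have g6 : d < col P k g := by
    rw [col_of_le g1]
    obtain ⟨s1, s2, s3⟩ := step_spec (h.supp.row k) g4
    by_contra hcon
    have s4 : c ≤ step (P k) (col P (k + 1) g) := by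
      by_contra hcon'
      have := g5 _ s1 (by omega)
      simp_all
    have := h.mid k _ (by omega) hk'.le s4 (by omega) (by omega) (by omega) (by omega)
    simp_all
  have hlt : ∀ y, y ≤ n → c ≤ col P b y → col P b y ≤ d → g < y ∧
      col P k y < col P k g ∧ col P (k + 1) g ≤ col P (k + 1) y := by
    intro y hy h1 h2
    have e1 := h.band hk hk'.le y (by omega)
    have e2 := h.band (i := k + 1) (by omega) (by omega) y (by omega)
    refine ⟨?_, by omega, by omega⟩
    by_contra hcon
    rcases (not_lt.1 hcon).eq_or_lt with he | he
    · subst he; omega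
    · have := hp y g k he g2 (by omega) (by omega)
      omega
  refine ⟨g, (hlt p hpn (by omega) (by omega)).1, fun y hy h1 h2 => ?_⟩
  obtain ⟨l1, l2, l3⟩ := hlt y hy h1.le h2
  have hT := (crossRow_eq_iff hp l1 hy (by omega)).2 ⟨l2, l3⟩
  refine ⟨hT, ?_⟩
  rw [h.crossRow_other hp l1 hy, hT]
  · rintro ⟨h3, -⟩
    have := h.band hk hk'.le g (by omega)
    omega
  · rintro ⟨h3, -⟩
    have := h.band hk hk'.le g (by omega)
    omega

theorem Chute.exists_left (h : Chute n P P' a b c d) :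
    ∃ p, b ≤ p ∧ p ≤ n ∧ col P b p = c := by
  have := h.hn
  have := h.hcd
  exact h.supp.exists_col (n + 1 - b) b c (by omega) h.hc (by omega)
    (by have := h.hab; omega)

theorem below_congr {T T' : ℕ → ℕ → ℕ} {p y t : ℕ}
    (h : ∀ i, i < p → (0 < T i y ∧ T i y < t ↔ 0 < T' i y ∧ T' i y < t)) :
    below T p y t = below T' p y t := by
  refine Finset.sum_congr rfl fun i hi => ?_
  simp only [Finset.mem_range] at hi
  simp only [h i hi]

theorem Chute.leh_eq (h : Chute n P P' a b c d) (hp : Persist n P) {x y : ℕ} (hxy : x < y)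
    (hy : y ≤ n) : leh (crossRow n P') x y =
      leh (crossRow n P) x y + if Changed P b c d x y then 1 else 0 := by
  have ha := h.ha
  have hab := h.hab
  have hT := tab_crossRow h.supp hp
  have hT' := tab_crossRow h.supp' (h.persist_result hp)
  by_cases hyb : c < col P b y ∧ col P b y ≤ d
  swap
  · have he : ∀ i, i < y → crossRow n P' i y = crossRow n P i y := fun i hi =>
      h.crossRow_other hp hi hy (by omega) (by omega)
    rw [if_neg (fun hE => hyb hE.2), leh, leh, he x hxy, add_zero]
    congr 1
    exact below_congr fun i hi => by rw [he i (by omega)]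
  obtain ⟨p, -, hpn, hpc⟩ := h.exists_left
  have hpy := (h.ord hp).left p y hpn hy hpc hyb.1 hyb.2
  obtain ⟨hTp, hTp'⟩ := h.crossRow_left hp hpn hy hpc hyb.1 hyb.2
  have hother : ∀ i, i < y → i ≠ p → ¬ (crossRow n P i y = b ∧ crossRow n P' i y = a ∧ p < i) →
      crossRow n P' i y = crossRow n P i y ∧ crossRow n P i y ≠ a ∧ crossRow n P i y ≠ b := by
    intro i hi hip hq
    have h1 : crossRow n P' i y = crossRow n P i y := by
      refine h.crossRow_other hp hi hy ?_ ?_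
      · rintro ⟨h1, -⟩
        exact hip (h.supp.col_inj (by omega) (by have := h.hc; omega) (h1.trans hpc.symm))
      · rintro ⟨h1, h2, h3⟩
        obtain ⟨h4, h5⟩ := h.crossRow_right hp (by omega) hy h1 h2 h3
        exact hq ⟨h4, h5, (h.ord hp).left p i hpn (by omega) hpc (by have := h.hcd; omega)
          (by omega)⟩
    have h2 : crossRow n P i y ≠ a := by
      intro h2
      rcases lt_or_gt_of_ne hip with h3 | h3
      · exact hT.inj i p y h3 hpy hy (by omega) (by omega)
      · exact hT.inj p i y h3 hi hy (by omega) (by omega)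
    have h3 : crossRow n P' i y ≠ b := by
      intro h2
      rcases lt_or_gt_of_ne hip with h3 | h3
      · exact hT'.inj i p y h3 hpy hy (by omega) (by omega)
      · exact hT'.inj p i y h3 hi hy (by omega) (by omega)
    exact ⟨h1, h2, h1 ▸ h3⟩
  have hbefore : ∀ i, i < p → crossRow n P' i y = crossRow n P i y := fun i hi =>
    (hother i (by omega) (by omega) (by omega)).1
  have hhit : ∀ k, a < k → k < b → ∃ g, g < p ∧ crossRow n P g y = k := by
    intro k hk hk'
    obtain ⟨g, hg, hg'⟩ := h.exists_hit hp hpn hpc hk hk'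
    exact ⟨g, hg, (hg' y hy hyb.1 hyb.2).1⟩
  rcases lt_trichotomy x p with hx | hx | hx
  · have hE : ¬ Changed P b c d x y := by
      rintro ⟨h1, -⟩
      have := h.supp.col_inj (by omega) (by have := h.hc; omega) (h1.trans hpc.symm)
      omega
    rw [if_neg hE, add_zero, leh, leh, hbefore x hx]
    congr 1
    exact below_congr fun i hi => by rw [hbefore i (by omega)]
  · subst hx
    rw [if_pos ⟨hpc, hyb⟩, leh, leh, hTp, hTp']
    have e1 : below (crossRow n P') x y b = below (crossRow n P) x y b :=
      below_congr fun i hi => by rw [hbefore i (by omega)]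
    have e2 := hT.below_lt hpy hy (t' := b) (by omega)
    have e3 := below_of_hit (crossRow n P) (p := x) (y := y) (s := a + 1) (t := b) (by omega) hab
      fun k hk hk' => hhit k hk hk'
    have e4 := below_succ (crossRow n P) x y a
    rw [hTp] at e2
    push_cast at e3
    omega
  · have hE : ¬ Changed P b c d x y := by
      rintro ⟨h1, -⟩
      have := h.supp.col_inj (by omega) (by have := h.hc; omega) (h1.trans hpc.symm)
      omega
    rw [if_neg hE, add_zero, leh, leh]
    by_cases hq : crossRow n P x y = b ∧ crossRow n P' x y = a ∧ p < x
    · have hne : ∀ i, i < x → i ≠ p →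
          ¬ (crossRow n P i y = b ∧ crossRow n P' i y = a ∧ p < i) := by
        rintro i hi - ⟨h1, -, -⟩
        exact hT.inj i x y hi hxy hy (by omega) (by omega)
      have e1 : below (crossRow n P') x y a = below (crossRow n P) x y a := by
        refine below_congr fun i hi => ?_
        by_cases hip : i = p
        · rw [hip, hTp, hTp']; omega
        · rw [(hother i (by omega) hip (hne i hi hip)).1]
      have e2 := below_of_hit (crossRow n P) (p := x) (y := y) (s := a) (t := b) (by omega)
        hab.le fun k hk hk' => by
          rcases hk.eq_or_lt with h1 | h1
          · exact ⟨p, hx, by omega⟩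
          · obtain ⟨g, hg, hg'⟩ := hhit k h1 hk'
            exact ⟨g, by omega, hg'⟩
      have e3 := hT.below_mono (p := x) hxy.le hy hab.le
      rw [hq.1, hq.2.1]
      omega
    · obtain ⟨o1, o2, o3⟩ := hother x hxy (by omega) hq
      rw [o1]
      congr 1
      have o4 : ¬ (a < crossRow n P x y ∧ crossRow n P x y < b) := by
        rintro ⟨h1, h2⟩
        obtain ⟨g, hg, hg'⟩ := hhit _ h1 h2
        exact hT.inj g x y (by omega) hxy hy (by omega) hg'
      refine below_congr fun i hi => ?_
      by_cases hip : i = p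
      · rw [hip, hTp, hTp']; omega
      · by_cases hq' : crossRow n P i y = b ∧ crossRow n P' i y = a ∧ p < i
        · rw [hq'.1, hq'.2.1]; omega
        · rw [(hother i (by omega) hip hq').1]

/-- The pairs `x < y ≤ n`. -/
def pairs (n : ℕ) : Finset (ℕ × ℕ) :=
  ((Finset.range (n + 1)) ×ˢ (Finset.range (n + 1))).filter fun z => z.1 < z.2

theorem mem_pairs {z : ℕ × ℕ} : z ∈ pairs n ↔ z.1 < z.2 ∧ z.2 ≤ n := by
  simp only [pairs, Finset.mem_filter, Finset.mem_product, Finset.mem_range]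
  omega

/-- The sum of the Lehmer entries. -/
def total (n : ℕ) (P : ℕ → ℕ → Bool) : ℤ := ∑ z ∈ pairs n, leh (crossRow n P) z.1 z.2

theorem Chute.card_changed (h : Chute n P P' a b c d) (hp : Persist n P) :
    ∑ z ∈ pairs n, (if Changed P b c d z.1 z.2 then 1 else 0 : ℤ) = d - c := by
  have hcd := h.hcd
  have hc := h.hc
  have hn := h.hn
  have hcard : ((pairs n).filter fun z => Changed P b c d z.1 z.2).card =
      (Finset.Ioc c d).card := by
    refine Finset.card_bij (fun z _ => col P b z.2) ?_ ?_ ?_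
    · intro z hz
      simp only [Finset.mem_filter] at hz
      simpa using hz.2.2
    · rintro ⟨x, y⟩ hz ⟨x', y'⟩ hz' he
      rw [Finset.mem_filter, mem_pairs] at hz hz'
      simp only [Changed] at hz hz' he
      have h1 := h.supp.col_inj (by omega) (by omega) (hz.2.1.trans hz'.2.1.symm)
      have h2 := h.supp.col_inj (by omega) (by omega) he
      rw [h1, h2]
    · intro j hj
      simp only [Finset.mem_Ioc] at hj
      obtain ⟨p, -, hpn, hpc⟩ := h.exists_left
      obtain ⟨y, -, hyn, hyc⟩ := h.supp.exists_col (n + 1 - b) b j (by omega) (by omega)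
        (by omega) (by have := h.hab; omega)
      refine ⟨(p, y), ?_, hyc⟩
      rw [Finset.mem_filter, mem_pairs]
      simp only [Changed]
      refine ⟨⟨(h.ord hp).left p y hpn hyn hpc (by omega) (by omega), hyn⟩, hpc, ?_⟩
      omega
  rw [Finset.sum_boole, hcard, Nat.card_Ioc]
  push_cast [hcd.le]
  rfl

theorem Chute.total_eq (h : Chute n P P' a b c d) (hp : Persist n P) :
    total n P' = total n P + (d - c) := by
  rw [total, total, ← h.card_changed hp, ← Finset.sum_add_distrib]
  refine Finset.sum_congr rfl fun z hz => ?_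
  rw [mem_pairs] at hz
  exact h.leh_eq hp hz.1 hz.2

end

section
variable {n a b c d : ℕ} {P P' : ℕ → ℕ → Bool}

theorem leh_nonneg (hP : Supp n P) (hp : Persist n P) {x y : ℕ} (hxy : x < y) (hy : y ≤ n) :
    0 ≤ leh (crossRow n P) x y := by
  have h := (tab_crossRow hP hp).below_mono hxy.le hy (Nat.zero_le (crossRow n P x y))
  have h0 : below (crossRow n P) x y 0 = 0 := by simp [below]
  rw [h0] at h
  rw [leh]
  push_cast at h
  omega

theorem leh_le (P : ℕ → ℕ → Bool) (x y : ℕ) : leh (crossRow n P) x y ≤ n := by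
  have h1 : crossRow n P x y ≤ n := Nat.findGreatest_le n
  have h2 : 0 ≤ below (crossRow n P) x y (crossRow n P x y) :=
    Finset.sum_nonneg fun i _ => by split_ifs <;> omega
  rw [leh]
  omega

theorem total_nonneg (hP : Supp n P) (hp : Persist n P) : 0 ≤ total n P :=
  Finset.sum_nonneg fun z hz => by
    rw [mem_pairs] at hz
    exact leh_nonneg hP hp hz.1 hz.2

theorem total_le (P : ℕ → ℕ → Bool) : total n P ≤ (pairs n).card * n := by
  rw [← nsmul_eq_mul]
  exact Finset.sum_le_card_nsmul _ _ _ fun z _ => leh_le P z.1 z.2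

theorem Chute.total_lt (h : Chute n P P' a b c d) (hp : Persist n P) :
    total n P < total n P' := by
  rw [h.total_eq hp]
  have := h.hcd
  omega

theorem Chute.of_isChuteRect (hP : Supp n P) (h : IsChuteRect n P a b c d) :
    Chute n P (chuteResult P a b c d) a b c d := by
  obtain ⟨h1, h2, h3, h4, h5, h6, h7, h8, h9⟩ := h
  refine ⟨h1, h2, h3, h4, h5, hP, ?_, h6, h7, h8, ?_, ?_, h9, ?_⟩
  · intro i j hij
    unfold chuteResult at hij
    split_ifs at hij with g1 g2
    · omega
    · exact hP i j hij
  · unfold chuteResult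
    rw [if_neg (by omega), if_pos ⟨rfl, rfl⟩]
  · unfold chuteResult
    rw [if_pos ⟨rfl, rfl⟩]
  · intro i j g1 g2
    unfold chuteResult
    rw [if_neg g2, if_neg g1]

theorem Chute.chuteStep (h : Chute n P P' a b c d) : ChuteStep n P P' := by
  refine ⟨a, b, c, d, ⟨h.ha, h.hab, h.hc, h.hcd, h.hn, h.ac, h.bc, h.bd, h.mid⟩, ?_⟩
  funext i j
  unfold chuteResult
  split_ifs with g1 g2
  · rw [g1.1, g1.2, h.bc']
  · rw [g2.1, g2.2, h.ad']
  · exact h.same i j g2 g1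

/-- In every row, the crosses are to the left of the bumps. -/
def LeftJustified (P : ℕ → ℕ → Bool) : Prop :=
  ∀ i j, 1 ≤ j → P i (j + 1) = true → P i j = true

theorem exists_chute_of_not_leftJustified (hP : Supp n P) (hp : Persist n P)
    (hL : ¬ LeftJustified P) : ∃ P' a b c d, Chute n P P' a b c d := by
  let bad : ℕ → Prop := fun i => ∃ j, 1 ≤ j ∧ P i (j + 1) = true ∧ P i j = false
  have hbad : ∃ i, bad i := by
    simp only [LeftJustified, not_forall] at hL
    obtain ⟨i, j, h1, h2, h3⟩ := hL
    exact ⟨i, j, h1, h2, by simpa using h3⟩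
  have hbd : ∀ i, bad i → i ≤ n := by
    rintro i ⟨j, -, h2, -⟩
    have := hP _ _ h2
    omega
  obtain ⟨i₀, hi₀⟩ := hbad
  obtain ⟨a, ha⟩ : ∃ a, Nat.findGreatest bad n = a := ⟨_, rfl⟩
  obtain ⟨c, hc, hac', hac⟩ : bad a := ha ▸ Nat.findGreatest_spec (hbd _ hi₀) hi₀
  have hmax : ∀ i, a < i → ¬ bad i := by
    intro i hi hb
    exact Nat.findGreatest_is_greatest (by rw [ha]; exact hi) (hbd i hb) hb
  have hex : ∃ b, a < b ∧ P b (c + 1) = false := by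
    have := hP _ _ hac'
    exact ⟨n, by omega, hP.eq_false (by omega)⟩
  obtain ⟨b, ⟨hab, hbc'⟩, hmin⟩ : ∃ b, (a < b ∧ P b (c + 1) = false) ∧
      ∀ i, i < b → ¬ (a < i ∧ P i (c + 1) = false) :=
    ⟨Nat.find hex, Nat.find_spec hex, fun i hi => Nat.find_min hex hi⟩
  have hcross' : ∀ i, a ≤ i → i < b → P i (c + 1) = true := by
    intro i hi hib
    rcases hi.eq_or_lt with h | h
    · rwa [← h]
    · have := hmin i hib
      simp only [not_and] at this
      simpa using this h
  have hcross : ∀ i, a < i → i < b → P i c = true := by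
    intro i hi hib
    by_contra hcon
    exact hmax i hi ⟨c, hc, hcross' i hi.le hib, by simpa using hcon⟩
  have ha1 := (hP _ _ hac').1
  have hn := (hP _ _ (hcross' (b - 1) (by omega) (by omega))).2.2
  rcases hbc : P b c with _ | _
  · refine ⟨_, a, b, c, c + 1, Chute.of_isChuteRect hP ⟨ha1, hab, hc, by omega, by omega, hac, hbc,
      hbc', fun i j h1 h2 h3 h4 h5 h6 h7 => ?_⟩⟩
    rcases h3.eq_or_lt with h | h
    · subst h
      exact hcross i (by omega) (by omega)
    · obtain rfl : j = c + 1 := by omega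
      exact hcross' i h1 (by omega)
  · exfalso
    obtain ⟨p, p1, p2, p3, p4, p5⟩ := hP.exists_horizontal (i := b) (j := c + 1) (by omega)
      (by omega) (by omega)
    have hpb := Horiz.step_eq ⟨p1, p2, p3, p4, p5⟩ hbc'
    obtain ⟨q, q1, q2, q3⟩ := hP.exists_col (n - b) (b + 1) c (by omega) hc (by omega) (by omega)
    have hqb : col P b q = c := by
      rw [col_of_le (by omega), q3, step_of_true hbc]
    have hvert : ∀ i, i ≤ b → a < i → col P i p = c + 1 ∧ col P i q = c := by
      intro i hi
      induction hi using Nat.decreasingInduction with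
      | self => exact fun _ => ⟨hpb, hqb⟩
      | of_succ k hk ih =>
        intro hak
        obtain ⟨e1, e2⟩ := ih (by omega)
        rw [col_of_le (v := p) (by omega), col_of_le (v := q) (by omega), e1, e2]
        exact ⟨step_of_true (hcross' k (by omega) (by omega)), step_of_true (hcross k hak (by omega))⟩
    obtain ⟨e1, e2⟩ := hvert (a + 1) (by omega) (by omega)
    have hpa : col P a p = c + 1 := by
      rw [col_of_le (by omega), e1, step_of_true hac']
    have hqa : c + 1 < col P a q := by
      rw [col_of_le (by omega), e2]
      obtain ⟨s1, s2, s3⟩ := step_spec (hP.row a) hac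
      rcases (Nat.succ_le_of_lt s1).eq_or_lt with h | h
      · rw [← h] at s2; simp_all
      · exact h
    have hlt : col P (b + 1) p < col P (b + 1) q := by
      rcases (Nat.lt_succ_iff.1 p3).eq_or_lt with h | h
      · rw [h] at p4; simp_all
      · omega
    rcases lt_trichotomy p q with h | h | h
    · have := hp p q a h q2 ha1 (by omega)
      omega
    · subst h; omega
    · have := hp q p b h p2 (by omega) hlt
      omega

theorem LeftJustified.row_eq (hP : Supp n P) (hL : LeftJustified P) {i : ℕ} (j : ℕ) :
    P i j = decide (0 < j ∧ j < col P i i) := by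
  have h1 : col P i i = step (P i) 0 := by
    rw [col_of_le le_rfl, col_of_lt (by omega)]
  obtain ⟨s1, s2, s3⟩ := step_spec (hP.row i) (hP.eq_false (i := i) (j := 0) (by omega))
  rw [← h1] at s1 s2 s3
  by_cases hj : 0 < j ∧ j < col P i i
  · rw [s3 j hj.1 hj.2]; simp [hj]
  · rw [decide_eq_false hj]
    rcases Nat.eq_zero_or_pos j with h0 | h0
    · exact hP.eq_false (by omega)
    · have hle : col P i i ≤ j := by omega
      clear hj h0
      induction j, hle using Nat.le_induction with
      | base => exact s2
      | succ k hk ih =>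
        by_contra hcon
        have := hL i k (by omega) (by simpa using hcon)
        simp_all

theorem LeftJustified.unique {w : Equiv.Perm (Fin n)} {R : ℕ → ℕ → Bool} (hP : Good w P)
    (hR : Good w R) (hLP : LeftJustified P) (hLR : LeftJustified R) : P = R := by
  have hrow : ∀ i, 1 ≤ i → i ≤ n → (∀ v, v ≤ n → col P i v = col R i v) → P i = R i := by
    intro i _ hi h
    funext j
    rw [hLP.row_eq hP.supp, hLR.row_eq hR.supp, h i hi]
  have hcol : ∀ i, 1 ≤ i → ∀ v, v ≤ n → col P i v = col R i v := by
    intro i hi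
    induction i, hi using Nat.le_induction with
    | base => exact fun v hv => hP.col_one hR hv
    | succ i hi ih =>
      intro v hv
      rcases lt_or_ge v (i + 1) with h | h
      · rw [col_of_lt h, col_of_lt h]
      · have h1 := ih v hv
        rw [col_of_le (by omega), col_of_le (P := R) (by omega),
          hrow i hi (by omega) ih] at h1
        exact step_injective (hR.supp.row i) h1
  funext i j
  by_cases hi : 1 ≤ i ∧ i ≤ n
  · rw [hrow i hi.1 hi.2 (hcol i hi.1)]
  · rw [hP.supp.eq_false (by omega), hR.supp.eq_false (by omega)]

end

/-! ### Inverse chute moves -/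

/-- The rectangle in rows `a < b` and columns `c < d` is the result of a chute move. -/
structure RevRect (n : ℕ) (J : ℕ → ℕ → Bool) (a b c d : ℕ) : Prop where
  ha : 1 ≤ a
  hab : a < b
  hc : 1 ≤ c
  hcd : c < d
  hn : b + d ≤ n + 1
  ac : J a c = false
  ad : J a d = false
  bd : J b d = false
  bc : J b c = true
  mid : ∀ i j, a ≤ i → i ≤ b → c ≤ j → j ≤ d → ¬(i = a ∧ j = c) → ¬(i = a ∧ j = d) →
    ¬(i = b ∧ j = d) → J i j = true

/-- The result of the inverse chute move in rows `a < b` and columns `c < d`. -/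
def undo (J : ℕ → ℕ → Bool) (a b c d : ℕ) : ℕ → ℕ → Bool :=
  fun i j => if i = a ∧ j = d then true else if i = b ∧ j = c then false else J i j

section
variable {n a b c d a₁ b₁ c₁ d₁ a₂ b₂ c₂ d₂ : ℕ} {J X Y : ℕ → ℕ → Bool}

theorem Chute.revRect (h : Chute n X J a b c d) : RevRect n J a b c d := by
  obtain ⟨ha, hab, hc, hcd, hn, -, -, h1, h2, h3, h4, h5, hm, hs⟩ := h
  refine ⟨ha, hab, hc, hcd, hn, ?_, h4, ?_, h5, fun i j g1 g2 g3 g4 g5 g6 g7 => ?_⟩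
  · rw [hs _ _ (by omega) (by omega), h1]
  · rw [hs _ _ (by omega) (by omega), h3]
  · by_cases hbc : i = b ∧ j = c
    · rw [hbc.1, hbc.2, h5]
    · rw [hs _ _ g6 hbc]
      exact hm i j g1 g2 g3 g4 g5 hbc g7

theorem Chute.eq_undo (h : Chute n X J a b c d) : X = undo J a b c d := by
  have hab := h.hab
  have hcd := h.hcd
  funext i j
  unfold undo
  split_ifs with h1 h2
  · rw [h1.1, h1.2]
    exact h.mid _ _ le_rfl hab.le hcd.le le_rfl (by omega) (by omega) (by omega)
  · rw [h2.1, h2.2, h.bc]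
  · exact (h.same i j h1 h2).symm

theorem RevRect.chute (hJ : Supp n J) (h : RevRect n J a b c d) :
    Chute n (undo J a b c d) J a b c d := by
  obtain ⟨ha, hab, hc, hcd, hn, h1, h2, h3, h4, hm⟩ := h
  have hs := fun i j => (hJ i j)
  refine ⟨ha, hab, hc, hcd, hn, fun i j hij => ?_, hJ, ?_, ?_, ?_, h2, h4, fun i j => ?_,
    fun i j => ?_⟩ <;> grind [undo]

theorem RevRect.trichotomy (h₁ : RevRect n J a₁ b₁ c₁ d₁) (h₂ : RevRect n J a₂ b₂ c₂ d₂) :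
    (a₁ = a₂ ∧ b₁ = b₂ ∧ c₁ = c₂ ∧ d₁ = d₂) ∨ RevRect n (undo J a₁ b₁ c₁ d₁) a₂ b₂ c₂ d₂ ∨
      (c₁ = d₂ ∧ a₁ = a₂ ∧ b₁ < b₂) ∨ (c₂ = d₁ ∧ a₁ = a₂ ∧ b₂ < b₁) ∨
      (b₁ = a₂ ∧ d₁ = d₂ ∧ c₂ < c₁) ∨ (b₂ = a₁ ∧ d₁ = d₂ ∧ c₁ < c₂) := by
  obtain ⟨ha, hab, hc, hcd, hn, h1, h2, h3, h4, hm⟩ := h₁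
  obtain ⟨ha', hab', hc', hcd', hn', h1', h2', h3', h4', hm'⟩ := h₂
  by_cases e1 : a₁ = a₂ ∧ d₁ = d₂
  · left
    grind
  by_cases e2 : b₁ = b₂ ∧ c₁ = c₂
  · left
    grind
  by_cases e3 : a₁ = a₂ ∧ d₁ = c₂
  · grind
  by_cases e4 : a₁ = b₂ ∧ d₁ = d₂
  · grind
  by_cases e5 : a₂ ≤ b₁ ∧ b₁ ≤ b₂ ∧ c₂ ≤ c₁ ∧ c₁ ≤ d₂
  · right; right
    grind
  · right; left
    refine ⟨ha', hab', hc', hcd', hn', ?_, ?_, ?_, ?_, fun i j g1 g2 g3 g4 g5 g6 g7 => ?_⟩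
    · grind [undo]
    · grind [undo]
    · grind [undo]
    · grind [undo]
    · unfold undo
      split_ifs with k1 k2
      · rfl
      · omega
      · exact hm' i j g1 g2 g3 g4 g5 g6 g7

theorem undo_undo (h₁ : RevRect n J a₁ b₁ c₁ d₁) (h₂ : RevRect n J a₂ b₂ c₂ d₂) :
    undo (undo J a₁ b₁ c₁ d₁) a₂ b₂ c₂ d₂ = undo (undo J a₂ b₂ c₂ d₂) a₁ b₁ c₁ d₁ := by
  have e1 := h₁.ad
  have e2 := h₁.bc
  have e3 := h₂.ad
  have e4 := h₂.bc
  funext i j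
  grind [undo]

theorem Chute.changed_iff (h : Chute n X J a b c d) (x y : ℕ) : Changed X b c d x y ↔
    col J b x = d ∧ c ≤ col J b y ∧ col J b y < d := by
  have hcd := h.hcd
  rw [Changed, h.col_mid x h.hab le_rfl, h.col_mid y h.hab le_rfl]
  unfold sw
  split_ifs <;> omega

theorem Chute.eq_of_changed (h₁ : Chute n X J a₁ b₁ c₁ d₁) (h₂ : Chute n Y J a₂ b₂ c₂ d₂)
    (hX : Persist n X) (hY : Persist n Y) {x y : ℕ} (hx : x ≤ n) (hy : y ≤ n)
    (e₁ : Changed X b₁ c₁ d₁ x y) (e₂ : Changed Y b₂ c₂ d₂ x y) : X = Y := by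
  obtain rfl : b₁ = b₂ := by
    rw [← (h₁.crossRow_left hX hx hy e₁.1 e₁.2.1 e₁.2.2).2,
      ← (h₂.crossRow_left hY hx hy e₂.1 e₂.2.1 e₂.2.2).2]
  rw [h₁.changed_iff] at e₁
  rw [h₂.changed_iff] at e₂
  obtain rfl : d₁ = d₂ := by rw [← e₁.1, ← e₂.1]
  have r₁ := h₁.revRect
  have r₂ := h₂.revRect
  have key : a₁ = a₂ ∧ c₁ = c₂ := by
    obtain ⟨ha, hab, hc, hcd, hn, h1, h2, h3, h4, hm⟩ := r₁
    obtain ⟨ha', hab', hc', hcd', hn', h1', h2', h3', h4', hm'⟩ := r₂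
    grind
  rw [h₁.eq_undo, h₂.eq_undo, key.1, key.2]

end

/-! ### Polygons -/

/-- Entrywise comparison of the Lehmer entries. -/
def LehLE (n : ℕ) (X Y : ℕ → ℕ → Bool) : Prop :=
  ∀ x y, x < y → y ≤ n → leh (crossRow n X) x y ≤ leh (crossRow n Y) x y

/-- `Y` is obtained from `X` by a sequence of chute moves. -/
def Reach (n : ℕ) : (ℕ → ℕ → Bool) → (ℕ → ℕ → Bool) → Prop :=
  Relation.ReflTransGen fun X Y => ∃ a b c d, Chute n X Y a b c d

section
variable {n a b c d a₁ b₁ c₁ d₁ a₂ b₂ c₂ d₂ : ℕ} {J X Y Z : ℕ → ℕ → Bool} {w : Equiv.Perm (Fin n)}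

theorem LehLE.trans (h : LehLE n X Y) (h' : LehLE n Y Z) : LehLE n X Z :=
  fun x y hxy hy => (h x y hxy hy).trans (h' x y hxy hy)

theorem Chute.lehLE (h : Chute n X Y a b c d) (hX : Persist n X) : LehLE n X Y := by
  intro x y hxy hy
  rw [h.leh_eq hX hxy hy]
  split_ifs <;> omega

theorem Chute.reach (h : Chute n X Y a b c d) : Reach n X Y :=
  .single ⟨a, b, c, d, h⟩

theorem eq_of_le_of_total {f g : ℕ → ℕ → ℤ} (h : ∀ x y, x < y → y ≤ n → f x y ≤ g x y)
    (ht : ∑ z ∈ pairs n, f z.1 z.2 = ∑ z ∈ pairs n, g z.1 z.2) {x y : ℕ} (hxy : x < y)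
    (hy : y ≤ n) : f x y = g x y :=
  (Finset.sum_eq_sum_iff_of_le fun z hz => h z.1 z.2 (mem_pairs.1 hz).1 (mem_pairs.1 hz).2).1 ht
    (x, y) (mem_pairs.2 ⟨hxy, hy⟩)

theorem lehLE_of_total (h₁ : Chute n X J a₁ b₁ c₁ d₁) (h₂ : Chute n Y J a₂ b₂ c₂ d₂)
    (hX : Persist n X) (hY : Persist n Y) (hne : X ≠ Y) (hZX : LehLE n Z X) (hZY : LehLE n Z Y)
    (ht : total n J = total n Z + (d₁ - c₁) + (d₂ - c₂)) {R : ℕ → ℕ → Bool}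
    (hRX : LehLE n R X) (hRY : LehLE n R Y) : LehLE n R Z := by
  have hdis : ∀ x y, x < y → y ≤ n → ¬ (Changed X b₁ c₁ d₁ x y ∧ Changed Y b₂ c₂ d₂ x y) :=
    fun x y hxy hy e => hne (h₁.eq_of_changed h₂ hX hY (by omega) hy e.1 e.2)
  have hsum : ∀ x y, x < y → y ≤ n → leh (crossRow n Z) x y
      + (if Changed X b₁ c₁ d₁ x y then 1 else 0) + (if Changed Y b₂ c₂ d₂ x y then 1 else 0)
      = leh (crossRow n J) x y := by
    intro x y hxy hy
    refine eq_of_le_of_total (f := fun x y => leh (crossRow n Z) x y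
      + (if Changed X b₁ c₁ d₁ x y then 1 else 0) + (if Changed Y b₂ c₂ d₂ x y then 1 else 0))
      (g := leh (crossRow n J)) ?_ ?_ hxy hy
    · intro x y hxy hy
      have e1 := h₁.leh_eq hX hxy hy
      have e2 := h₂.leh_eq hY hxy hy
      have e3 := hZX x y hxy hy
      have e4 := hZY x y hxy hy
      have e5 := hdis x y hxy hy
      split_ifs at * <;> first | omega | tauto
    · rw [Finset.sum_add_distrib, Finset.sum_add_distrib, h₁.card_changed hX, h₂.card_changed hY]
      exact ht.symm
  intro x y hxy hy
  have e1 := h₁.leh_eq hX hxy hy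
  have e2 := h₂.leh_eq hY hxy hy
  have e3 := hRX x y hxy hy
  have e4 := hRY x y hxy hy
  have e5 := hdis x y hxy hy
  have e6 := hsum x y hxy hy
  split_ifs at * <;> first | omega | tauto

/-- Two chute moves with the same result, in rectangles that do not interact. -/
theorem meet_square (h₁ : Chute n X J a₁ b₁ c₁ d₁) (h₂ : Chute n Y J a₂ b₂ c₂ d₂)
    (hX : Persist n X) (hY : Persist n Y) (hne : X ≠ Y)
    (hr₁ : RevRect n X a₂ b₂ c₂ d₂) (hr₂ : RevRect n Y a₁ b₁ c₁ d₁) :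
    ∃ Z, Reach n Z X ∧ Reach n Z Y ∧
      ∀ R, LehLE n R X → LehLE n R Y → LehLE n R Z := by
  have k₁ := hr₁.chute h₁.supp
  have k₂ := hr₂.chute h₂.supp
  have he : undo Y a₁ b₁ c₁ d₁ = undo X a₂ b₂ c₂ d₂ := by
    rw [h₁.eq_undo, h₂.eq_undo, undo_undo h₂.revRect h₁.revRect]
  rw [he] at k₂
  have hZ := k₁.persist_of_result hX
  refine ⟨_, k₁.reach, k₂.reach, fun R => lehLE_of_total h₁ h₂ hX hY hne (k₁.lehLE hZ)
    (k₂.lehLE hZ) ?_⟩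
  rw [h₁.total_eq hX, k₁.total_eq hZ]
  ring

/-- Two chute moves with the same result, in rectangles one above the other. -/
theorem meet_vertical {m : ℕ} (h₁ : Chute n X J a m c₁ d) (h₂ : Chute n Y J m b c₂ d)
    (hX : Persist n X) (hY : Persist n Y) (hc : c₂ < c₁) :
    ∃ Z, Reach n Z X ∧ Reach n Z Y ∧
      ∀ R, LehLE n R X → LehLE n R Y → LehLE n R Z := by
  have r₁ : RevRect n X m b c₁ d := by
    rw [h₁.eq_undo]
    obtain ⟨ha, hab, hc, hcd, hn, h1, h2, h3, h4, hm⟩ := h₁.revRect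
    obtain ⟨ha', hab', hc', hcd', hn', h1', h2', h3', h4', hm'⟩ := h₂.revRect
    refine ⟨?_, ?_, ?_, ?_, ?_, ?_, ?_, ?_, ?_, fun i j g1 g2 g3 g4 g5 g6 g7 => ?_⟩ <;>
      grind [undo]
  have k₁ := r₁.chute h₁.supp
  obtain ⟨X', hX'⟩ : ∃ X', X' = undo X m b c₁ d := ⟨_, rfl⟩
  rw [← hX'] at k₁
  have r₂ : RevRect n X' m b c₂ c₁ := by
    rw [hX', h₁.eq_undo]
    obtain ⟨ha, hab, hc, hcd, hn, h1, h2, h3, h4, hm⟩ := h₁.revRect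
    obtain ⟨ha', hab', hc', hcd', hn', h1', h2', h3', h4', hm'⟩ := h₂.revRect
    refine ⟨?_, ?_, ?_, ?_, ?_, ?_, ?_, ?_, ?_, fun i j g1 g2 g3 g4 g5 g6 g7 => ?_⟩ <;>
      grind [undo]
  have k₂ := r₂.chute k₁.supp
  obtain ⟨Z, hZ⟩ : ∃ Z, Z = undo X' m b c₂ c₁ := ⟨_, rfl⟩
  rw [← hZ] at k₂
  have r₃ : RevRect n Y a b c₁ d := by
    rw [h₂.eq_undo]
    obtain ⟨ha, hab, hc, hcd, hn, h1, h2, h3, h4, hm⟩ := h₁.revRect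
    obtain ⟨ha', hab', hc', hcd', hn', h1', h2', h3', h4', hm'⟩ := h₂.revRect
    refine ⟨?_, ?_, ?_, ?_, ?_, ?_, ?_, ?_, ?_, fun i j g1 g2 g3 g4 g5 g6 g7 => ?_⟩ <;>
      grind [undo]
  have k₃ := r₃.chute h₂.supp
  have he : undo Y a b c₁ d = Z := by
    rw [hZ, hX', h₁.eq_undo, h₂.eq_undo]
    obtain ⟨ha, hab, hc, hcd, hn, h1, h2, h3, h4, hm⟩ := h₁.revRect
    obtain ⟨ha', hab', hc', hcd', hn', h1', h2', h3', h4', hm'⟩ := h₂.revRect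
    funext i j
    grind [undo]
  rw [he] at k₃
  have p₁ := k₁.persist_of_result hX
  have p₂ := k₂.persist_of_result p₁
  have hne : X ≠ Y := by
    intro h
    have e1 := h₂.mid m c₁ le_rfl h₂.hab.le hc.le h₁.hcd.le (by omega) (by omega)
      (by have := h₂.hab; omega)
    rw [← h, h₁.bc] at e1
    exact Bool.noConfusion e1
  refine ⟨Z, k₂.reach.trans k₁.reach, k₃.reach, fun R => lehLE_of_total h₁ h₂ hX hY hne
    ((k₂.lehLE p₂).trans (k₁.lehLE p₁)) (k₃.lehLE p₂) ?_⟩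
  rw [h₁.total_eq hX, k₁.total_eq p₁, k₂.total_eq p₂]
  ring

end

section
variable {n a b c d e : ℕ} {J X Y Z P P' : ℕ → ℕ → Bool} {w : Equiv.Perm (Fin n)}

theorem Chute.band_result (h : Chute n P P' a b c d) {i : ℕ} (hi : a < i) (hi' : i ≤ b) (v : ℕ)
    (hv : (c ≤ col P' i v ∧ col P' i v ≤ d) ∨ (c ≤ col P' b v ∧ col P' b v ≤ d)) :
    col P' i v = col P' b v := by
  have hcd := h.hcd
  have hs : ∀ j, c ≤ sw c d j ∧ sw c d j ≤ d ↔ c ≤ j ∧ j ≤ d := by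
    intro j
    unfold sw
    split_ifs <;> omega
  rw [h.col_mid v hi hi', h.col_mid v h.hab le_rfl, hs, hs] at hv
  rw [h.col_mid v hi hi', h.col_mid v h.hab le_rfl, h.band hi hi' v hv]

/-- `Z` is a lower bound of `X` and `Y`, above every lower bound in the Lehmer order. -/
def IsLehMeet (w : Equiv.Perm (Fin n)) (X Y Z : ℕ → ℕ → Bool) : Prop :=
  Reach n Z X ∧ Reach n Z Y ∧ ∀ R, Good w R → LehLE n R X → LehLE n R Y → LehLE n R Z

theorem IsLehMeet.symm (h : IsLehMeet w X Y Z) : IsLehMeet w Y X Z :=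
  ⟨h.2.1, h.1, fun R hR h1 h2 => h.2.2 R hR h2 h1⟩

/-- Two chute moves with the same result, in rectangles one beside the other. -/
theorem meet_horizontal {b₁ b₂ : ℕ} (h₁ : Chute n X J a b₁ e d) (h₂ : Chute n Y J a b₂ c e)
    (hX : Good w X) (hY : Good w Y) (hb : b₁ < b₂) :
    ∃ Z, IsLehMeet w X Y Z := by
  have r₁ : RevRect n X a b₁ c e := by
    rw [h₁.eq_undo]
    obtain ⟨ha, hab, hc, hcd, hn, h1, h2, h3, h4, hm⟩ := h₁.revRect
    obtain ⟨ha', hab', hc', hcd', hn', h1', h2', h3', h4', hm'⟩ := h₂.revRect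
    refine ⟨?_, ?_, ?_, ?_, ?_, ?_, ?_, ?_, ?_, fun i j g1 g2 g3 g4 g5 g6 g7 => ?_⟩ <;>
      grind [undo]
  have k₁ := r₁.chute h₁.supp
  obtain ⟨W, hW⟩ : ∃ W, W = undo X a b₁ c e := ⟨_, rfl⟩
  rw [← hW] at k₁
  have r₂ : RevRect n W b₁ b₂ c e := by
    rw [hW, h₁.eq_undo]
    obtain ⟨ha, hab, hc, hcd, hn, h1, h2, h3, h4, hm⟩ := h₁.revRect
    obtain ⟨ha', hab', hc', hcd', hn', h1', h2', h3', h4', hm'⟩ := h₂.revRect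
    refine ⟨?_, ?_, ?_, ?_, ?_, ?_, ?_, ?_, ?_, fun i j g1 g2 g3 g4 g5 g6 g7 => ?_⟩ <;>
      grind [undo]
  have k₂ := r₂.chute k₁.supp
  obtain ⟨Z, hZ⟩ : ∃ Z, Z = undo W b₁ b₂ c e := ⟨_, rfl⟩
  rw [← hZ] at k₂
  have r₃ : RevRect n Y a b₁ c d := by
    rw [h₂.eq_undo]
    obtain ⟨ha, hab, hc, hcd, hn, h1, h2, h3, h4, hm⟩ := h₁.revRect
    obtain ⟨ha', hab', hc', hcd', hn', h1', h2', h3', h4', hm'⟩ := h₂.revRect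
    refine ⟨?_, ?_, ?_, ?_, ?_, ?_, ?_, ?_, ?_, fun i j g1 g2 g3 g4 g5 g6 g7 => ?_⟩ <;>
      grind [undo]
  have k₃ := r₃.chute h₂.supp
  have he : undo Y a b₁ c d = Z := by
    rw [hZ, hW, h₁.eq_undo, h₂.eq_undo]
    obtain ⟨ha, hab, hc, hcd, hn, h1, h2, h3, h4, hm⟩ := h₁.revRect
    obtain ⟨ha', hab', hc', hcd', hn', h1', h2', h3', h4', hm'⟩ := h₂.revRect
    funext i j
    grind [undo]
  rw [he] at k₃
  have pX := hX.persist
  have pY := hY.persist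
  have pW := k₁.persist_of_result pX
  have pZ := k₂.persist_of_result pW
  have gJ := h₁.good_result hX
  have hae := h₁.hab
  have hce := h₂.hcd
  have hed := h₁.hcd
  have hc0 := h₂.hc
  have ha0 := h₂.ha
  have hZX : LehLE n Z X := (k₂.lehLE pZ).trans (k₁.lehLE pW)
  have hZY : LehLE n Z Y := k₃.lehLE pZ
  have cB : ∀ x y, Changed X b₁ e d x y ↔ col J b₁ x = d ∧ e ≤ col J b₁ y ∧ col J b₁ y < d :=
    h₁.changed_iff
  have cA : ∀ x y, Changed Y b₂ c e x y ↔ col J b₁ x = e ∧ c ≤ col J b₁ y ∧ col J b₁ y < e := by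
    intro x y
    have e1 := h₂.band_result hae hb.le x
    have e2 := h₂.band_result hae hb.le y
    rw [h₂.changed_iff]
    omega
  have cC : ∀ x y, Changed W b₁ c e x y ↔ col J b₁ x = d ∧ c ≤ col J b₁ y ∧ col J b₁ y < e := by
    intro x y
    rw [k₁.changed_iff, h₁.col_mid x hae le_rfl, h₁.col_mid y hae le_rfl]
    unfold sw
    split_ifs <;> omega
  have hsum : ∀ x y, x < y → y ≤ n → leh (crossRow n Z) x y
      + (if Changed X b₁ e d x y then 1 else 0) + (if Changed Y b₂ c e x y then 1 else 0)
      + (if Changed W b₁ c e x y then 1 else 0) = leh (crossRow n J) x y := by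
    intro x y hxy hy
    refine eq_of_le_of_total (f := fun x y => leh (crossRow n Z) x y
      + (if Changed X b₁ e d x y then 1 else 0) + (if Changed Y b₂ c e x y then 1 else 0)
      + (if Changed W b₁ c e x y then 1 else 0))
      (g := leh (crossRow n J)) ?_ ?_ hxy hy
    · intro x y hxy hy
      have e1 := h₁.leh_eq pX hxy hy
      have e2 := h₂.leh_eq pY hxy hy
      have e3 := k₁.leh_eq pW hxy hy
      have e4 := k₂.lehLE pZ x y hxy hy
      have e5 := hZY x y hxy hy
      rw [cB] at *
      rw [cA] at *
      rw [cC] at *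
      split_ifs at * <;> omega
    · rw [Finset.sum_add_distrib, Finset.sum_add_distrib, Finset.sum_add_distrib,
        h₁.card_changed pX, h₂.card_changed pY, k₁.card_changed pW]
      change total n Z + _ + _ + _ = total n J
      rw [h₁.total_eq pX, k₁.total_eq pW, k₂.total_eq pZ]
      ring
  refine ⟨Z, k₂.reach.trans k₁.reach, k₃.reach, fun R hR hRX hRY p r hpr hr => ?_⟩
  have hRJ : LehLE n R J := hRX.trans (h₁.lehLE pX)
  have e1 := h₁.leh_eq pX hpr hr
  have e2 := h₂.leh_eq pY hpr hr
  have e3 := hRX p r hpr hr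
  have e4 := hRY p r hpr hr
  have e6 := hsum p r hpr hr
  by_cases hC : Changed W b₁ c e p r
  swap
  · rw [if_neg hC] at e6
    rw [cB] at *
    rw [cA] at *
    split_ifs at * <;> omega
  have hlt : leh (crossRow n R) p r < leh (crossRow n J) p r := by
    obtain ⟨q, q1, q2, q3⟩ := gJ.supp.exists_col (n + 1 - b₁) b₁ e (by have := h₂.hn; omega)
      (by omega) (by have := h₂.hn; omega) (by omega)
    have hC' := (cC p r).1 hC
    have hB : Changed X b₁ e d p q := (cB p q).2 (by omega)
    have hA : Changed Y b₂ c e q r := (cA q r).2 (by omega)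
    have hpq := (h₁.ord pX).left p q (by omega) q2 hB.1 hB.2.1 hB.2.2
    have hqr := (h₂.ord pY).left q r q2 hr hA.1 hA.2.1 hA.2.2
    have s1 := (h₁.crossRow_left pX (by omega) q2 hB.1 hB.2.1 hB.2.2).2
    have s2 := (h₂.crossRow_left pY q2 hr hA.1 hA.2.1 hA.2.2).2
    have s3 := (k₁.crossRow_left pW (by omega) hr hC.1 hC.2.1 hC.2.2).2
    have hpX : ¬ Changed X b₁ e d p r := by
      rw [cB]
      omega
    have s4 : crossRow n J p r = b₁ := by
      rw [h₁.crossRow_other pX hpr hr hpX, s3]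
      rintro ⟨t, -⟩
      have := (h₁.changed_iff p q).1 hB
      have := hB.1
      omega
    refine Tab.leh_lt_of_leh_lt (tab_crossRow hR.supp hR.persist)
      (tab_crossRow gJ.supp gJ.persist) (hR.crossRow_eq_zero_iff gJ) hRJ hpq hqr hr (by omega)
      s1 s4 (by omega) ?_ ?_ ?_ ?_
    · intro k hk hk'
      obtain ⟨g, g1, g2⟩ := h₂.exists_hit pY (k := k) q2 hA.1 (by omega) (by omega)
      exact ⟨g, g1, (g2 r hr hA.2.1 hA.2.2).2⟩
    · intro i hpi hiq hi hir
      have t1 := (crossRow_eq_iff gJ.persist hpi (by omega) (by omega)).1 hi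
      have t2 := (le_crossRow_iff gJ.persist (i := b₁) (by omega) hr (by omega)).1 hir.le
      rcases lt_trichotomy (col J b₁ i) e with t | t | t
      · have t3 := h₂.band_result hae hb.le i (by omega)
        have t4 : Changed Y b₂ c e q i := (cA q i).2 (by omega)
        have := (h₂.ord pY).left q i q2 (by omega) t4.1 t4.2.1 t4.2.2
        omega
      · have := gJ.supp.col_inj (i := b₁) (u := i) (v := q) (by omega) (by omega) (by omega)
        omega
      · have t3 : Changed X b₁ e d p i := (cB p i).2 (by omega)
        have t4 := h₁.col_mid q hae le_rfl
        have t5 := h₁.col_mid i hae le_rfl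
        have := (h₁.ord pX).right q i q2 (by omega) (by
          unfold sw at t4; split_ifs at t4 <;> omega) t3.2.1 (by
          unfold sw at t5; split_ifs at t5 <;> omega)
        omega
    · have := h₁.leh_eq pX hpq q2
      rw [if_pos hB] at this
      have := hRX p q hpq q2
      omega
    · have := h₂.leh_eq pY hqr hr
      rw [if_pos hA] at this
      have := hRY q r hqr hr
      omega
  rw [if_pos hC] at e6
  have hC' := (cC p r).1 hC
  rw [cB, cA] at e6
  rw [if_neg (by omega), if_neg (by omega)] at e6
  omega

theorem exists_isLehMeet {a₁ b₁ c₁ d₁ a₂ b₂ c₂ d₂ : ℕ} (h₁ : Chute n X J a₁ b₁ c₁ d₁)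
    (h₂ : Chute n Y J a₂ b₂ c₂ d₂) (hX : Good w X) (hY : Good w Y) (hne : X ≠ Y) :
    ∃ Z, IsLehMeet w X Y Z := by
  by_cases hA : c₁ = d₂ ∧ a₁ = a₂ ∧ b₁ < b₂
  · obtain ⟨rfl, rfl, hb⟩ := hA
    exact meet_horizontal h₁ h₂ hX hY hb
  by_cases hA' : c₂ = d₁ ∧ a₁ = a₂ ∧ b₂ < b₁
  · obtain ⟨rfl, rfl, hb⟩ := hA'
    exact (meet_horizontal h₂ h₁ hY hX hb).imp fun _ => IsLehMeet.symm
  by_cases hB : b₁ = a₂ ∧ d₁ = d₂ ∧ c₂ < c₁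
  · obtain ⟨rfl, rfl, hc⟩ := hB
    obtain ⟨Z, z1, z2, z3⟩ := meet_vertical h₁ h₂ hX.persist hY.persist hc
    exact ⟨Z, z1, z2, fun R _ => z3 R⟩
  by_cases hB' : b₂ = a₁ ∧ d₁ = d₂ ∧ c₁ < c₂
  · obtain ⟨rfl, rfl, hc⟩ := hB'
    obtain ⟨Z, z1, z2, z3⟩ := meet_vertical h₂ h₁ hY.persist hX.persist hc
    exact ⟨Z, z2, z1, fun R _ h h' => z3 R h' h⟩
  have h0 : ¬ (a₁ = a₂ ∧ b₁ = b₂ ∧ c₁ = c₂ ∧ d₁ = d₂) := by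
    rintro ⟨rfl, rfl, rfl, rfl⟩
    exact hne (h₁.eq_undo.trans h₂.eq_undo.symm)
  have t₁ : RevRect n X a₂ b₂ c₂ d₂ := by
    rw [h₁.eq_undo]
    rcases h₁.revRect.trichotomy h₂.revRect with h | h | h
    · exact absurd h h0
    · exact h
    · omega
  have t₂ : RevRect n Y a₁ b₁ c₁ d₁ := by
    rw [h₂.eq_undo]
    rcases h₂.revRect.trichotomy h₁.revRect with h | h | h
    · omega
    · exact h
    · omega
  obtain ⟨Z, z1, z2, z3⟩ := meet_square h₁ h₂ hX.persist hY.persist hne t₁ t₂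
  exact ⟨Z, z1, z2, fun R _ => z3 R⟩

end

/-! ### The lattice property -/

section
variable {n : ℕ} {X Y Z P Q R U V J : ℕ → ℕ → Bool} {w : Equiv.Perm (Fin n)}

theorem Reach.good (h : Reach n X Y) (hY : Good w Y) : Good w X := by
  induction h using Relation.ReflTransGen.head_induction_on with
  | refl => exact hY
  | head h _ ih =>
    obtain ⟨a, b, c, d, h⟩ := h
    exact h.good_of_result ih

theorem Reach.good_right (h : Reach n X Y) (hX : Good w X) : Good w Y := by
  induction h with
  | refl => exact hX
  | tail _ h ih =>
    obtain ⟨a, b, c, d, h⟩ := h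
    exact h.good_result ih

theorem Reach.lehLE (h : Reach n X Y) (hX : Good w X) : LehLE n X Y := by
  induction h with
  | refl => exact fun _ _ _ _ => le_rfl
  | tail h' h ih =>
    obtain ⟨a, b, c, d, h⟩ := h
    exact ih.trans (h.lehLE (Reach.good_right h' hX).persist)

theorem LehLE.total_le (h : LehLE n X Y) : total n X ≤ total n Y :=
  Finset.sum_le_sum fun z hz => h z.1 z.2 (mem_pairs.1 hz).1 (mem_pairs.1 hz).2

theorem Reach.eq_of_total_le (h : Reach n X Y) (hX : Good w X) (ht : total n Y ≤ total n X) :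
    X = Y := by
  rcases Relation.ReflTransGen.cases_tail h with h | ⟨Z, hZ, a, b, c, d, hZY⟩
  · exact h.symm
  · have h1 := (Reach.lehLE hZ hX).total_le
    have h2 := hZY.total_lt (Reach.good_right hZ hX).persist
    omega

theorem Reach.antisymm (h : Reach n X Y) (h' : Reach n Y X) (hX : Good w X) : X = Y :=
  h.eq_of_total_le hX (h'.lehLE (h.good_right hX)).total_le

theorem reach_of_lehLE (hZ : Good w Z) (hP : Reach n P Z) (hR : Reach n R Z) (h : LehLE n R P) :
    Reach n R P := by
  obtain ⟨k, hk⟩ : ∃ k : ℕ, total n Z < k := ⟨(total n Z + 1).toNat, by omega⟩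
  induction k generalizing Z P R with
  | zero =>
    have := total_nonneg hZ.supp hZ.persist
    omega
  | succ k ih =>
    have gP := hP.good hZ
    have gR := hR.good hZ
    rcases Relation.ReflTransGen.cases_tail hP with e | ⟨X, hX, hXZ⟩
    · rwa [← e]
    rcases Relation.ReflTransGen.cases_tail hR with e | ⟨Y, hY, hYZ⟩
    · rw [hP.eq_of_total_le gP (by rw [e]; exact h.total_le)]
      exact hR
    obtain ⟨a₁, b₁, c₁, d₁, h₁⟩ := hXZ
    obtain ⟨a₂, b₂, c₂, d₂, h₂⟩ := hYZ
    have gX := h₁.good_of_result hZ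
    have gY := h₂.good_of_result hZ
    have tX := h₁.total_lt gX.persist
    have tY := h₂.total_lt gY.persist
    by_cases hXY : X = Y
    · subst hXY
      exact ih gX hX hY h (by omega)
    obtain ⟨M, m1, m2, m3⟩ := exists_isLehMeet h₁ h₂ gX gY hXY
    have hRM : LehLE n R M := m3 R gR (h.trans (Reach.lehLE hX gP)) (Reach.lehLE hY gR)
    have hRM' : Reach n R M := ih gY m2 hY hRM (by omega)
    exact ih gX hX (hRM'.trans m1) h (by omega)

/-- `M` is the greatest lower bound of `P` and `Q`. -/
def IsMeet (n : ℕ) (M P Q : ℕ → ℕ → Bool) : Prop :=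
  Reach n M P ∧ Reach n M Q ∧ ∀ R, Reach n R P → Reach n R Q → Reach n R M

theorem exists_isMeet (hZ : Good w Z) (hP : Reach n P Z) (hQ : Reach n Q Z) :
    ∃ M, IsMeet n M P Q := by
  obtain ⟨k, hk⟩ : ∃ k : ℕ, total n Z < k := ⟨(total n Z + 1).toNat, by omega⟩
  induction k generalizing Z P Q with
  | zero =>
    have := total_nonneg hZ.supp hZ.persist
    omega
  | succ k ih =>
    rcases Relation.ReflTransGen.cases_tail hP with e | ⟨X, hX, hXZ⟩
    · subst e
      exact ⟨Q, hQ, .refl, fun R _ h => h⟩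
    rcases Relation.ReflTransGen.cases_tail hQ with e | ⟨Y, hY, hYZ⟩
    · subst e
      exact ⟨P, .refl, hP, fun R h _ => h⟩
    obtain ⟨a₁, b₁, c₁, d₁, h₁⟩ := hXZ
    obtain ⟨a₂, b₂, c₂, d₂, h₂⟩ := hYZ
    have gX := h₁.good_of_result hZ
    have gY := h₂.good_of_result hZ
    have tX := h₁.total_lt gX.persist
    have tY := h₂.total_lt gY.persist
    by_cases hXY : X = Y
    · subst hXY
      exact ih gX hX hY (by omega)
    obtain ⟨M, m1, m2, m3⟩ := exists_isLehMeet h₁ h₂ gX gY hXY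
    have hM : ∀ R, Reach n R X → Reach n R Y → Reach n R M := by
      intro R r1 r2
      have gR := r1.good gX
      exact reach_of_lehLE gY m2 r2 (m3 R gR (r1.lehLE gR) (r2.lehLE gR))
    obtain ⟨A, α1, α2, α3⟩ := ih gX hX m1 (by omega)
    obtain ⟨B, β1, β2, β3⟩ := ih gY (α2.trans m2) hY (by omega)
    refine ⟨B, β1.trans α1, β2, fun R r1 r2 => β3 R (α3 R r1 (hM R ?_ ?_)) r2⟩
    · exact r1.trans hX
    · exact r2.trans hY

theorem exists_leftJustified (hP : Good w P) : ∃ Z, Reach n P Z ∧ LeftJustified Z := by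
  obtain ⟨k, hk⟩ : ∃ k : ℕ, (pairs n).card * n - total n P < k :=
    ⟨((pairs n).card * n - total n P + 1).toNat, by omega⟩
  induction k generalizing P with
  | zero =>
    have := total_le (n := n) P
    omega
  | succ k ih =>
    by_cases hL : LeftJustified P
    · exact ⟨P, .refl, hL⟩
    obtain ⟨P', a, b, c, d, h⟩ := exists_chute_of_not_leftJustified hP.supp hP.persist hL
    have ht := h.total_lt hP.persist
    obtain ⟨Z, z1, z2⟩ := ih (h.good_result hP) (by omega)
    exact ⟨Z, h.reach.trans z1, z2⟩

theorem exists_reach_reach (hP : Good w P) (hQ : Good w Q) : ∃ Z, Reach n P Z ∧ Reach n Q Z := by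
  obtain ⟨Z, z1, z2⟩ := exists_leftJustified hP
  obtain ⟨Z', z1', z2'⟩ := exists_leftJustified hQ
  obtain rfl := LeftJustified.unique (z1.good_right hP) (z1'.good_right hQ) z2 z2'
  exact ⟨Z, z1, z1'⟩

theorem exists_isMeet_of_good (hP : Good w P) (hQ : Good w Q) : ∃ M, IsMeet n M P Q := by
  obtain ⟨Z, z1, z2⟩ := exists_reach_reach hP hQ
  exact exists_isMeet (z1.good_right hP) z1 z2

theorem exists_isJoin_of_good (hP : Good w P) (hQ : Good w Q) :
    ∃ U, Reach n P U ∧ Reach n Q U ∧ ∀ V, Reach n P V → Reach n Q V → Reach n U V := by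
  obtain ⟨Z, z1, z2⟩ := exists_reach_reach hP hQ
  obtain ⟨k, hk⟩ : ∃ k : ℕ, total n Z < k := ⟨(total n Z + 1).toNat, by omega⟩
  induction k generalizing Z with
  | zero =>
    have := total_nonneg (z1.good_right hP).supp (z1.good_right hP).persist
    omega
  | succ k ih =>
    by_cases hU : ∃ V, Reach n P V ∧ Reach n Q V ∧ ¬ Reach n Z V
    · obtain ⟨V, v1, v2, v3⟩ := hU
      have gZ := z1.good_right hP
      obtain ⟨M, m1, m2, m3⟩ := exists_isMeet_of_good gZ (v1.good_right hP)
      refine ih M (m3 P z1 v1) (m3 Q z2 v2) ?_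
      by_contra hc
      have e := m1.eq_of_total_le (m1.good gZ) (by omega)
      rw [e] at m2
      exact v3 m2
    · exact ⟨Z, z1, z2, fun V v1 v2 => by
        by_contra hc
        exact hU ⟨V, v1, v2, hc⟩⟩

theorem reach_iff {P Q : RPD w} : chuteLE w P Q ↔ Reach n P.1 Q.1 := by
  constructor
  · intro h
    induction h with
    | refl => exact .refl
    | @tail X Y _ h ih =>
      obtain ⟨a, b, c, d, h1, h2⟩ := h
      rw [h2]
      exact ih.tail ⟨a, b, c, d, .of_isChuteRect ((good_iff w).2 X.2).supp h1⟩
  · intro h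
    obtain ⟨Q, hQ⟩ := Q
    obtain ⟨P, hP⟩ := P
    change Reach n P Q at h
    induction h with
    | refl => exact .refl
    | tail h' h ih =>
      have g := (good_iff w).1 (Reach.good_right h' ((good_iff w).2 hP))
      obtain ⟨a, b, c, d, h⟩ := h
      exact Relation.ReflTransGen.tail (ih g) h.chuteStep

end

end PipeDream

/-- the chute move poset `PD(w)` is a lattice: the chute move order is a
partial order (reflexive and transitive by construction, and antisymmetric), and every
pair of elements has a greatest lower bound and a least upper bound. -/
theorem chute_poset_is_lattice {n : ℕ} (w : Equiv.Perm (Fin n)) :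
    (∀ P Q : RPD w, chuteLE w P Q → chuteLE w Q P → P = Q) ∧
      (∀ P Q : RPD w, ∃ m, IsMeetOf w m P Q) ∧
      ∀ P Q : RPD w, ∃ s, IsJoinOf w s P Q := by
  have good := fun P : RPD w => (PipeDream.good_iff w).2 P.2
  simp only [IsMeetOf, IsJoinOf, PipeDream.reach_iff]
  refine ⟨fun P Q h h' => Subtype.ext (h.antisymm h' (good P)), fun P Q => ?_, fun P Q => ?_⟩
  · obtain ⟨M, m1, m2, m3⟩ := PipeDream.exists_isMeet_of_good (good P) (good Q)
    exact ⟨⟨M, (PipeDream.good_iff w).1 (m1.good (good P))⟩, m1, m2, fun R => m3 R.1⟩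
  · obtain ⟨U, u1, u2, u3⟩ := PipeDream.exists_isJoin_of_good (good P) (good Q)
    exact ⟨⟨U, (PipeDream.good_iff w).1 (u1.good_right (good P))⟩, u1, u2, fun R => u3 R.1⟩
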